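/- There is a universal constant c > 0 such that for every isotropic logconcave probability density p on ℝⁿ whose support has diameter at most D, the log-Sobolev inequality holds with constant c/D: for every smooth function f : ℝⁿ → ℝ with ∫ f(x)² p(x) dx = 1, one has ∫ ‖∇f(x)‖₂² p(x) dx ≥ (c/D) · ∫ f(x)² log(f(x)²) p(x) dx. -/

import Mathlib

open MeasureTheory Real Filter

noncomputable section

/-- A nonnegative function is logconcave if
`p (l • x + (1-l) • y) ≥ p x ^ l * p y ^ (1-l)` for all `x, y` and `l ∈ [0,1]`. -/
def IsLogConcave {n : ℕ} (p : EuclideanSpace ℝ (Fin n) → ℝ) : Prop :=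
  ∀ x y : EuclideanSpace ℝ (Fin n), ∀ l : ℝ, 0 ≤ l → l ≤ 1 →
    p x ^ l * p y ^ (1 - l) ≤ p (l • x + (1 - l) • y)

/-- `p` is a probability density on `ℝⁿ`. -/
def IsDensity {n : ℕ} (p : EuclideanSpace ℝ (Fin n) → ℝ) : Prop :=
  (∀ x, 0 ≤ p x) ∧ Integrable p ∧ (∫ x, p x) = 1

/-- `p` is isotropic: zero mean and identity covariance. -/
def IsIsotropic {n : ℕ} (p : EuclideanSpace ℝ (Fin n) → ℝ) : Prop :=
  (∫ x, p x • x) = 0 ∧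
  ∀ i j : Fin n, (∫ x, p x * (x i * x j)) = if i = j then 1 else 0

open scoped ENNReal Pointwise Topology InnerProductSpace

/-- Brunn–Minkowski inequality on the line, for measurable sets. -/
theorem volume_add_volume_le_of_add_subset {A B C : Set ℝ} (hA : MeasurableSet A)
    (hB : MeasurableSet B) (hA' : A.Nonempty) (hB' : B.Nonempty) (h : A + B ⊆ C) :
    volume A + volume B ≤ volume C := by
  have key : ∀ K : Set ℝ, K ⊆ A → IsCompact K → K.Nonempty → ∀ L : Set ℝ, L ⊆ B → IsCompact L →
      L.Nonempty → volume K + volume L ≤ volume C := by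
    intro K hKA hK hKn L hLB hL hLn
    obtain ⟨a, ha, hamax⟩ := hK.exists_isGreatest hKn
    obtain ⟨b, hb, hbmin⟩ := hL.exists_isLeast hLn
    have e1 : volume ((fun x => x + b) '' K) = volume K := by
      rw [Set.image_add_right, measure_preimage_add_right]
    have e2 : volume ((fun x => a + x) '' L) = volume L := by
      rw [Set.image_add_left, measure_preimage_add]
    have hm : MeasurableSet ((fun x => a + x) '' L) :=
      (hL.image (by fun_prop)).isClosed.measurableSet
    have hd : AEDisjoint volume ((fun x => x + b) '' K) ((fun x => a + x) '' L) := by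
      refine measure_mono_null (t := {a + b}) ?_ (by simp)
      rintro _ ⟨⟨x, hx, rfl⟩, y, hy, hxy⟩
      have h1 := hamax hx
      have h2 := hbmin hy
      simp only [Set.mem_singleton_iff] at hxy ⊢
      linarith
    rw [← e1, ← e2, ← measure_union₀ hm.nullMeasurableSet hd]
    apply measure_mono
    rintro _ (⟨x, hx, rfl⟩ | ⟨x, hx, rfl⟩)
    · exact h (Set.add_mem_add (hKA hx) (hLB hb))
    · exact h (Set.add_mem_add (hKA ha) (hLB hx))
  obtain ⟨a₀, ha₀⟩ := hA'
  obtain ⟨b₀, hb₀⟩ := hB'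
  have reg : ∀ X : Set ℝ, MeasurableSet X →
      volume X = ⨆ K, ⨆ (_ : K ⊆ X ∧ IsCompact K), volume K := fun X hX => by
    rw [hX.measure_eq_iSup_isCompact]; simp_rw [iSup_and]
  rw [reg A hA, reg B hB]
  refine ENNReal.biSup_add_biSup_le' ⟨∅, by simp⟩ ⟨∅, by simp⟩ ?_
  rintro K ⟨hKA, hK⟩ L ⟨hLB, hL⟩
  calc volume K + volume L ≤ volume (insert a₀ K) + volume (insert b₀ L) := by
        gcongr <;> exact Set.subset_insert _ _
    _ ≤ volume C := key _ (Set.insert_subset ha₀ hKA) (hK.insert _) (Set.insert_nonempty _ _) _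
        (Set.insert_subset hb₀ hLB) (hL.insert _) (Set.insert_nonempty _ _)

/-- The layer cake formula for a function bounded by `1`. -/
theorem lintegral_eq_lintegral_Ioo_meas_lt {f : ℝ → ℝ≥0∞} (hf : Measurable f)
    (h1 : ∀ x, f x ≤ 1) :
    ∫⁻ x, f x = ∫⁻ s in Set.Ioo (0 : ℝ) 1, volume {x | ENNReal.ofReal s < f x} := by
  have hfin : ∀ x, f x ≠ ∞ := fun x => ((h1 x).trans_lt (by simp)).ne
  have e : ∀ x, f x = ENNReal.ofReal (f x).toReal := fun x => (ENNReal.ofReal_toReal (hfin x)).symm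
  rw [lintegral_congr e, lintegral_eq_lintegral_meas_lt _
    (Eventually.of_forall fun _ => ENNReal.toReal_nonneg) hf.ennreal_toReal.aemeasurable]
  have e2 : ∀ s : ℝ, 0 < s → {a | s < (f a).toReal} = {x | ENNReal.ofReal s < f x} := by
    intro s hs
    ext x
    simp only [Set.mem_ofPred_eq]
    rw [ENNReal.ofReal_lt_iff_lt_toReal hs.le (hfin x)]
  rw [setLIntegral_congr_fun measurableSet_Ioi (fun s hs => by rw [e2 s hs])]
  rw [← Set.Ioo_union_Ici_eq_Ioi (zero_lt_one (α := ℝ)), lintegral_union measurableSet_Ici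
    (by rw [Set.disjoint_left]; intro x hx hx'; exact absurd hx.2 (not_lt.2 hx'))]
  have : ∫⁻ s in Set.Ici (1 : ℝ), volume {x | ENNReal.ofReal s < f x} = 0 := by
    rw [setLIntegral_congr_fun (g := fun _ => 0) measurableSet_Ici, lintegral_zero]
    intro s hs
    have : {x | ENNReal.ofReal s < f x} = ∅ := by
      ext x
      simp only [Set.mem_ofPred_eq, Set.mem_empty_iff_false, iff_false, not_lt]
      exact (h1 x).trans (by simpa using hs)
    simp [this]
  rw [this, add_zero]

theorem ENNReal.geom_mean_le_arith_mean_weighted (a b : ℝ≥0∞) {l : ℝ} (h0 : 0 < l) (h1 : l < 1) :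
    a ^ l * b ^ (1 - l) ≤ ENNReal.ofReal l * a + ENNReal.ofReal (1 - l) * b := by
  have h1' : 0 < 1 - l := by linarith
  rcases eq_or_ne a ∞ with rfl | ha
  · simp [ENNReal.mul_top, h0]
  rcases eq_or_ne b ∞ with rfl | hb
  · simp [ENNReal.mul_top, h1]
  lift a to NNReal using ha
  lift b to NNReal using hb
  have := NNReal.geom_mean_le_arith_mean2_weighted ⟨l, h0.le⟩ ⟨1 - l, h1'.le⟩ a b
    (Subtype.ext (add_sub_cancel l 1))
  rw [← ENNReal.coe_rpow_of_nonneg _ h0.le, ← ENNReal.coe_rpow_of_nonneg _ h1'.le,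
    ENNReal.ofReal_eq_coe_nnreal h0.le, ENNReal.ofReal_eq_coe_nnreal h1'.le]
  exact_mod_cast this

/-- The one-dimensional Prékopa–Leindler inequality for functions with supremum `1`. -/
theorem prekopa_leindler_real_of_iSup_eq_one {l : ℝ} (h0 : 0 < l) (h1 : l < 1)
    {u v w : ℝ → ℝ≥0∞} (hu : Measurable u) (hv : Measurable v) (hw : Measurable w)
    (hu1 : ⨆ x, u x = 1) (hv1 : ⨆ x, v x = 1)
    (h : ∀ x y, u x ^ l * v y ^ (1 - l) ≤ w (l * x + (1 - l) * y)) :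
    (∫⁻ x, u x) ^ l * (∫⁻ x, v x) ^ (1 - l) ≤ ∫⁻ x, w x := by
  have h1' : 0 < 1 - l := by linarith
  have ub : ∀ x, u x ≤ 1 := fun x => hu1 ▸ le_iSup u x
  have vb : ∀ x, v x ≤ 1 := fun x => hv1 ▸ le_iSup v x
  refine (ENNReal.geom_mean_le_arith_mean_weighted _ _ h0 h1).trans ?_
  refine le_trans ?_ (lintegral_mono (f := fun x => min (w x) 1) fun x => min_le_left _ _)
  rw [lintegral_eq_lintegral_Ioo_meas_lt hu ub, lintegral_eq_lintegral_Ioo_meas_lt hv vb,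
    lintegral_eq_lintegral_Ioo_meas_lt (hw.min measurable_const) (fun x => min_le_right _ _),
    ← lintegral_const_mul' _ _ ENNReal.ofReal_ne_top,
    ← lintegral_const_mul' _ _ ENNReal.ofReal_ne_top]
  have hmeas : ∀ f : ℝ → ℝ≥0∞,
      Measurable fun s : ℝ => volume {x | ENNReal.ofReal s < f x} := fun f =>
    Antitone.measurable fun s t hst => measure_mono fun x hx =>
      lt_of_le_of_lt (ENNReal.ofReal_le_ofReal hst) hx
  rw [← lintegral_add_left ((hmeas u).const_mul _)]
  refine setLIntegral_mono (hmeas _) fun s hs => ?_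
  have hs1 : ENNReal.ofReal s < 1 := by
    rw [← ENNReal.ofReal_one]; exact (ENNReal.ofReal_lt_ofReal_iff zero_lt_one).2 hs.2
  obtain ⟨x₀, hx₀⟩ := lt_iSup_iff.1 (hu1 ▸ hs1)
  obtain ⟨y₀, hy₀⟩ := lt_iSup_iff.1 (hv1 ▸ hs1)
  have eA : ENNReal.ofReal l * volume {x | ENNReal.ofReal s < u x} =
      volume (l • {x | ENNReal.ofReal s < u x}) := by
    rw [Measure.addHaar_smul]; simp [abs_of_pos h0]
  have eB : ENNReal.ofReal (1 - l) * volume {x | ENNReal.ofReal s < v x} =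
      volume ((1 - l) • {x | ENNReal.ofReal s < v x}) := by
    rw [Measure.addHaar_smul]; simp [abs_of_pos h1']
  rw [eA, eB]
  refine volume_add_volume_le_of_add_subset ((measurableSet_lt measurable_const hu).const_smul₀ _)
    ((measurableSet_lt measurable_const hv).const_smul₀ _) ⟨l • x₀, Set.smul_mem_smul_set hx₀⟩
    ⟨(1 - l) • y₀, Set.smul_mem_smul_set hy₀⟩ ?_
  rintro _ ⟨_, ⟨x, hx, rfl⟩, _, ⟨y, hy, rfl⟩, rfl⟩
  simp only [Set.mem_ofPred_eq, smul_eq_mul, lt_min_iff] at hx hy ⊢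
  refine ⟨lt_of_lt_of_le ?_ (h x y), hs1⟩
  have hs0 : ENNReal.ofReal s ≠ 0 := by simpa using hs.1
  calc ENNReal.ofReal s = ENNReal.ofReal s ^ l * ENNReal.ofReal s ^ (1 - l) := by
        rw [← ENNReal.rpow_add _ _ hs0 ENNReal.ofReal_ne_top]; simp
    _ < u x ^ l * v y ^ (1 - l) :=
        ENNReal.mul_lt_mul (ENNReal.rpow_lt_rpow hx h0) (ENNReal.rpow_lt_rpow hy h1')

/-- The one-dimensional Prékopa–Leindler inequality for bounded functions. -/
theorem prekopa_leindler_real_of_bounded {l : ℝ} (h0 : 0 < l) (h1 : l < 1)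
    {u v w : ℝ → ℝ≥0∞} (hu : Measurable u) (hv : Measurable v) (hw : Measurable w)
    (hu1 : ⨆ x, u x ≠ ∞) (hv1 : ⨆ x, v x ≠ ∞)
    (h : ∀ x y, u x ^ l * v y ^ (1 - l) ≤ w (l * x + (1 - l) * y)) :
    (∫⁻ x, u x) ^ l * (∫⁻ x, v x) ^ (1 - l) ≤ ∫⁻ x, w x := by
  have h1' : 0 < 1 - l := by linarith
  set a := ⨆ x, u x with ha
  set b := ⨆ x, v x with hb
  rcases eq_or_ne a 0 with ha0 | ha0
  · have : ∀ x, u x = 0 := fun x => le_antisymm (ha0 ▸ le_iSup u x) zero_le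
    simp [this, h0]
  rcases eq_or_ne b 0 with hb0 | hb0
  · have : ∀ x, v x = 0 := fun x => le_antisymm (hb0 ▸ le_iSup v x) zero_le
    simp [this, h1]
  have hal : a ^ l ≠ 0 := by simp [ha0, hu1]
  have hal' : a ^ l ≠ ∞ := by simp [ha0, hu1]
  have hbl : b ^ (1 - l) ≠ 0 := by simp [hb0, hv1]
  have hbl' : b ^ (1 - l) ≠ ∞ := by simp [hb0, hv1]
  have hc : (a ^ l * b ^ (1 - l)) ≠ 0 := mul_ne_zero hal hbl
  have hc' : (a ^ l * b ^ (1 - l)) ≠ ∞ := ENNReal.mul_ne_top hal' hbl'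
  have split : ∀ p q : ℝ≥0∞, (a⁻¹ * p) ^ l * (b⁻¹ * q) ^ (1 - l) =
      (a ^ l * b ^ (1 - l))⁻¹ * (p ^ l * q ^ (1 - l)) := by
    intro p q
    rw [ENNReal.mul_rpow_of_nonneg _ _ h0.le, ENNReal.mul_rpow_of_nonneg _ _ h1'.le,
      ENNReal.inv_rpow, ENNReal.inv_rpow, ENNReal.mul_inv (Or.inl hal) (Or.inl hal')]
    ring
  have key := prekopa_leindler_real_of_iSup_eq_one h0 h1 (u := fun x => a⁻¹ * u x)
    (v := fun x => b⁻¹ * v x) (w := fun x => (a ^ l * b ^ (1 - l))⁻¹ * w x)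
    (hu.const_mul _) (hv.const_mul _) (hw.const_mul _)
    (by rw [← ENNReal.mul_iSup, ENNReal.inv_mul_cancel ha0 hu1])
    (by rw [← ENNReal.mul_iSup, ENNReal.inv_mul_cancel hb0 hv1])
    (fun x y => by rw [split]; gcongr; exact h x y)
  rw [lintegral_const_mul _ hu, lintegral_const_mul _ hv, lintegral_const_mul _ hw, split] at key
  exact (ENNReal.mul_le_mul_iff_right (ENNReal.inv_ne_zero.2 hc') (ENNReal.inv_ne_top.2 hc)).1 key

/-- The one-dimensional Prékopa–Leindler inequality. -/
theorem prekopa_leindler_real {l : ℝ} (h0 : 0 < l) (h1 : l < 1)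
    {u v w : ℝ → ℝ≥0∞} (hu : Measurable u) (hv : Measurable v) (hw : Measurable w)
    (h : ∀ x y, u x ^ l * v y ^ (1 - l) ≤ w (l * x + (1 - l) * y)) :
    (∫⁻ x, u x) ^ l * (∫⁻ x, v x) ^ (1 - l) ≤ ∫⁻ x, w x := by
  have h1' : 0 < 1 - l := by linarith
  rcases eq_or_ne (∫⁻ x, u x) 0 with hu0 | hu0
  · simp [hu0, h0]
  rcases eq_or_ne (∫⁻ x, v x) 0 with hv0 | hv0
  · simp [hv0, h1]
  have approx : ∀ f : ℝ → ℝ≥0∞, Measurable f →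
      Tendsto (fun N : ℕ => ∫⁻ x, min (f x) N) atTop (nhds (∫⁻ x, f x)) := by
    intro f hf
    refine lintegral_tendsto_of_tendsto_of_monotone
      (fun N => (hf.min measurable_const).aemeasurable)
      (Eventually.of_forall fun x N M hNM => min_le_min le_rfl (by exact_mod_cast hNM))
      (Eventually.of_forall fun x => ?_)
    have := (tendsto_const_nhds (x := f x)).min ENNReal.tendsto_nat_nhds_top
    simpa using this
  have lim := ENNReal.Tendsto.mul
    ((ENNReal.continuous_rpow_const (y := l)).continuousAt.tendsto.comp (approx u hu))
    (Or.inl (by simp [hu0, h0, ENNReal.rpow_eq_zero_iff, not_lt.2 h0.le]))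
    ((ENNReal.continuous_rpow_const (y := 1 - l)).continuousAt.tendsto.comp (approx v hv))
    (Or.inl (by simp [hv0, h1, ENNReal.rpow_eq_zero_iff, not_lt.2 h1.le]))
  refine le_of_tendsto' lim fun N => ?_
  refine prekopa_leindler_real_of_bounded h0 h1 (hu.min measurable_const)
    (hv.min measurable_const) hw ?_ ?_ fun x y => ?_
  · exact ((iSup_le fun x => min_le_right _ _).trans_lt (ENNReal.natCast_lt_top N)).ne
  · exact ((iSup_le fun x => min_le_right _ _).trans_lt (ENNReal.natCast_lt_top N)).ne
  · refine le_trans ?_ (h x y)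
    gcongr <;> exact min_le_left _ _

theorem lintegral_fin_succ {n : ℕ} {f : (Fin (n + 1) → ℝ) → ℝ≥0∞} (hf : Measurable f) :
    ∫⁻ x, f x = ∫⁻ a : ℝ, ∫⁻ x : Fin n → ℝ, f (Fin.cons a x) := by
  have e := (volume_preserving_piFinSuccAbove (fun _ : Fin (n + 1) => ℝ) 0).symm
  rw [← e.lintegral_comp_emb (MeasurableEquiv.measurableEmbedding _), Measure.volume_eq_prod,
    lintegral_prod]
  · simp [MeasurableEquiv.piFinSuccAbove_symm_apply, Fin.insertNthEquiv]
  · exact (hf.comp (MeasurableEquiv.measurable _)).aemeasurable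

theorem measurable_finCons {n : ℕ} :
    Measurable fun z : ℝ × (Fin n → ℝ) => (Fin.cons z.1 z.2 : Fin (n + 1) → ℝ) := by
  refine measurable_pi_lambda _ fun i => ?_
  refine Fin.cases ?_ (fun j => ?_) i
  · simpa using measurable_fst
  · simp only [Fin.cons_succ]; fun_prop

/-- The Prékopa–Leindler inequality on `Fin n → ℝ`. -/
theorem prekopa_leindler_pi {l : ℝ} (h0 : 0 < l) (h1 : l < 1) (n : ℕ)
    {u v w : (Fin n → ℝ) → ℝ≥0∞} (hu : Measurable u) (hv : Measurable v) (hw : Measurable w)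
    (h : ∀ x y, u x ^ l * v y ^ (1 - l) ≤ w (l • x + (1 - l) • y)) :
    (∫⁻ x, u x) ^ l * (∫⁻ x, v x) ^ (1 - l) ≤ ∫⁻ x, w x := by
  induction n with
  | zero =>
    have hvol : (volume : Measure (Fin 0 → ℝ)) Set.univ = 1 := by simp [volume_pi]
    simp only [lintegral_unique, hvol, mul_one]
    exact (h _ _).trans_eq (congrArg w (Subsingleton.elim _ _))
  | succ n ih =>
    rw [lintegral_fin_succ hu, lintegral_fin_succ hv, lintegral_fin_succ hw]
    have hm : ∀ f : (Fin (n + 1) → ℝ) → ℝ≥0∞, Measurable f →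
        Measurable fun a : ℝ => ∫⁻ x : Fin n → ℝ, f (Fin.cons a x) := fun f hf =>
      Measurable.lintegral_prod_right' (f := fun z : ℝ × (Fin n → ℝ) => f (Fin.cons z.1 z.2))
        (hf.comp measurable_finCons)
    refine prekopa_leindler_real h0 h1 (hm u hu) (hm v hv) (hm w hw) fun a b => ?_
    have hs : ∀ f : (Fin (n + 1) → ℝ) → ℝ≥0∞, Measurable f → ∀ a : ℝ,
        Measurable fun x : Fin n → ℝ => f (Fin.cons a x) := fun f hf a =>
      hf.comp (measurable_finCons.comp measurable_prodMk_left)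
    refine ih (hs u hu a) (hs v hv b) (hs w hw _) fun x y => ?_
    convert h (Fin.cons a x) (Fin.cons b y) using 2
    ext i
    refine Fin.cases ?_ (fun j => ?_) i <;> simp

/-- The Prékopa–Leindler inequality on Euclidean space. -/
theorem prekopa_leindler {l : ℝ} (h0 : 0 < l) (h1 : l < 1) {n : ℕ}
    {u v w : EuclideanSpace ℝ (Fin n) → ℝ≥0∞} (hu : Measurable u) (hv : Measurable v)
    (hw : Measurable w) (h : ∀ x y, u x ^ l * v y ^ (1 - l) ≤ w (l • x + (1 - l) • y)) :
    (∫⁻ x, u x) ^ l * (∫⁻ x, v x) ^ (1 - l) ≤ ∫⁻ x, w x := by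
  have hT := PiLp.volume_preserving_toLp (Fin n)
  have hi := fun f (hf : Measurable f) => hT.lintegral_comp (f := f) hf
  rw [← hi u hu, ← hi v hv, ← hi w hw]
  exact prekopa_leindler_pi h0 h1 n (hu.comp hT.measurable) (hv.comp hT.measurable)
    (hw.comp hT.measurable) fun x y => h _ _

theorem le_of_hasDerivAt_of_nonneg_right {φ : ℝ → ℝ} {φ' δ₀ : ℝ} (hφ : HasDerivAt φ φ' 0)
    (h0 : φ 0 = 0) (hδ : 0 < δ₀) (h : ∀ δ, 0 < δ → δ < δ₀ → 0 ≤ φ δ) : 0 ≤ φ' := by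
  have h1 := (hasDerivAt_iff_tendsto_slope.1 hφ).mono_left
    (nhdsWithin_mono 0 (show Set.Ioi (0 : ℝ) ⊆ {0}ᶜ from fun x hx => by
      simpa using (ne_of_gt hx)))
  refine ge_of_tendsto h1 ?_
  filter_upwards [Ioo_mem_nhdsGT hδ] with δ hδ'
  rw [slope_def_field, h0]
  have := h δ hδ'.1 hδ'.2
  have h2 := hδ'.1
  simp only [sub_zero]
  positivity

/-- Second-order upper Taylor bound, uniform on a ball. -/
theorem exists_le_add_inner_gradient_add {n : ℕ} {g : EuclideanSpace ℝ (Fin n) → ℝ}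
    (hg : ContDiff ℝ (⊤ : ℕ∞) g) (R : ℝ) :
    ∃ M : ℝ, 0 < M ∧ ∀ x z : EuclideanSpace ℝ (Fin n), ‖x‖ ≤ R → ‖z‖ ≤ R →
      g x ≤ g z + ‖gradient g z‖ * ‖x - z‖ + M / 2 * ‖x - z‖ ^ 2 := by
  have hg1 : ContDiff ℝ 1 (fderiv ℝ g) := hg.fderiv_right (by norm_cast)
  have hd2 := hg1.continuous_fderiv one_ne_zero
  have hd3 : Continuous fun y => ‖fderiv ℝ (fderiv ℝ g) y‖ := hd2.norm
  obtain ⟨C, hC⟩ := (isCompact_closedBall (0 : EuclideanSpace ℝ (Fin n)) R).exists_bound_of_continuousOn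
    hd3.continuousOn
  refine ⟨2 * max C 1, by positivity, fun x z hx hz => ?_⟩
  have hconv := convex_closedBall (0 : EuclideanSpace ℝ (Fin n)) R
  have hlip : ∀ y, ‖y‖ ≤ R → ‖fderiv ℝ g y - fderiv ℝ g z‖ ≤ max C 1 * ‖y - z‖ := fun y hy =>
    hconv.norm_image_sub_le_of_norm_fderiv_le (f := fderiv ℝ g) (𝕜 := ℝ)
      (fun w _ => (hg1.differentiable one_ne_zero) w)
      (fun w hw => ((norm_norm _).symm.le.trans (hC w hw)).trans (le_max_left _ _)) (by simpa using hz) (by simpa using hy)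
  have hseg : segment ℝ z x ⊆ Metric.closedBall (0 : EuclideanSpace ℝ (Fin n)) R :=
    hconv.segment_subset (by simpa using hz) (by simpa using hx)
  have hmain := (convex_segment z x).norm_image_sub_le_of_norm_fderiv_le' (𝕜 := ℝ) (f := g)
    (φ := fderiv ℝ g z) (C := max C 1 * ‖x - z‖)
    (fun w _ => (hg.differentiable (by simp)) w)
    (fun w hw => by
      refine (hlip w (by simpa using hseg hw)).trans ?_
      gcongr
      obtain ⟨a, b, ha, hb, hab, rfl⟩ := hw
      have e : a • z + b • x - z = b • (x - z) := by
        have : a = 1 - b := by linarith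
        rw [this]; module
      rw [e, norm_smul, Real.norm_of_nonneg hb]
      exact mul_le_of_le_one_left (norm_nonneg _) (by linarith))
    (left_mem_segment ℝ z x) (right_mem_segment ℝ z x)
  have h2 : fderiv ℝ g z (x - z) ≤ ‖gradient g z‖ * ‖x - z‖ := by
    have e : fderiv ℝ g z (x - z) = inner ℝ (gradient g z) (x - z) := by
      simp [gradient]
    rw [e]
    exact real_inner_le_norm _ _
  have h3 := (abs_le.1 (Real.norm_eq_abs _ ▸ hmain)).2
  nlinarith

theorem Continuous.integrable_of_ae_norm_le {n : ℕ} {ν : Measure (EuclideanSpace ℝ (Fin n))}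
    [IsFiniteMeasure ν] {R : ℝ} (hR : ∀ᵐ x ∂ν, ‖x‖ ≤ R) {φ : EuclideanSpace ℝ (Fin n) → ℝ}
    (hφ : Continuous φ) : Integrable φ ν := by
  obtain ⟨C, hC⟩ := (isCompact_closedBall (0 : EuclideanSpace ℝ (Fin n)) R).exists_bound_of_continuousOn
    hφ.continuousOn
  exact Integrable.of_bound hφ.aestronglyMeasurable C
    (hR.mono fun x hx => hC x (by simpa using hx))

theorem ContDiff.continuous_gradient' {n : ℕ} {g : EuclideanSpace ℝ (Fin n) → ℝ}
    (hg : ContDiff ℝ (⊤ : ℕ∞) g) : Continuous (gradient g) := by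
  have := hg.continuous_fderiv (by simp)
  unfold gradient
  fun_prop

theorem exp_add_div_le {t M δ L w g : ℝ} (ht : 0 < t) (hM : 0 < M) (h0 : 0 < δ) (hL1 : 1 ≤ L)
    (hwx : 0 ≤ w) (hx : w ≤ L) (hs1 : M * δ ≤ t / 2) (hs2 : δ * L ≤ t) :
    exp (g + δ * w / (2 * (t - M * δ))) ≤ exp g + δ * (1 / (2 * t)) * (w * exp g)
      + ((L * M / t ^ 2 + (L / t) ^ 2) * δ ^ 2) * exp g := by
  rw [exp_add]
  set y := δ * w / (2 * (t - M * δ)) with hy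
  have htp : 0 < t - M * δ := by linarith
  have hy0 : 0 ≤ y := by positivity
  have hyL : y ≤ δ * L / t := by
    rw [hy, div_le_div_iff₀ (by positivity) ht]
    have h1 : δ * w ≤ δ * L := by gcongr
    have h2 : t ≤ 2 * (t - M * δ) := by linarith
    calc δ * w * t ≤ δ * L * t := by gcongr
      _ ≤ _ := by gcongr
  have hy1 : y ≤ 1 := hyL.trans ((div_le_one ht).2 hs2)
  have hyw : y ≤ δ * (1 / (2 * t)) * w + L * M / t ^ 2 * δ ^ 2 := by
    have e1 : y = δ * (1 / (2 * t)) * w + δ * w * (M * δ) / (2 * t * (t - M * δ)) := by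
      obtain ⟨s, hs⟩ : ∃ s, s = t - M * δ := ⟨_, rfl⟩
      have hM' : M * δ = t - s := by linarith
      rw [← hs] at htp
      rw [hy, hM', sub_sub_cancel]
      field_simp
      ring
    rw [e1]
    gcongr
    rw [div_mul_eq_mul_div, div_le_div_iff₀ (by positivity) (by positivity)]
    have h5 : w * t ^ 2 ≤ L * (2 * t * (t - M * δ)) := by
      have : t ^ 2 ≤ 2 * t * (t - M * δ) := by nlinarith
      calc w * t ^ 2 ≤ L * t ^ 2 := by gcongr
        _ ≤ _ := by gcongr
    have h6 : 0 ≤ δ * (M * δ) := by positivity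
    have := mul_le_mul_of_nonneg_left h5 h6
    linarith
  have hexp : exp y ≤ 1 + y + y ^ 2 := by
    have := abs_le.1 (abs_exp_sub_one_sub_id_le (by rw [abs_of_nonneg hy0]; exact hy1))
    linarith [this.2]
  have hy2 : y ^ 2 ≤ (L / t) ^ 2 * δ ^ 2 := by
    have : y ^ 2 ≤ (δ * L / t) ^ 2 := by gcongr
    calc y ^ 2 ≤ (δ * L / t) ^ 2 := this
      _ = _ := by ring
  calc exp g * exp y ≤ exp g * (1 + δ * (1 / (2 * t)) * w
        + (L * M / t ^ 2 + (L / t) ^ 2) * δ ^ 2) := by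
        gcongr
        linarith
    _ = _ := by ring

/-- Passage to the limit in the Prékopa–Leindler inequality. -/
theorem entropy_exp_le_of_forall_small {n : ℕ} {ν : Measure (EuclideanSpace ℝ (Fin n))}
    [IsFiniteMeasure ν] {R : ℝ} (hR : ∀ᵐ x ∂ν, ‖x‖ ≤ R) {Q : ℝ}
    (hA : 0 < ν Set.univ) {t M : ℝ} (ht : 0 < t) (hM : 0 < M)
    {g w : EuclideanSpace ℝ (Fin n) → ℝ} (hg : Continuous g) (hw : Continuous w)
    (hw0 : ∀ x, 0 ≤ w x)
    (h : ∀ δ : ℝ, 0 < δ → M * δ < t → log (∫ x, exp ((1 + δ) * g x) ∂ν) + δ * log Q ≤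
      (1 + δ) * log (∫ x, exp (g x + δ * w x / (2 * (t - M * δ))) ∂ν)) :
    ∫ x, g x * exp (g x) ∂ν - (∫ x, exp (g x) ∂ν) * (log (∫ x, exp (g x) ∂ν) - log Q) ≤
      1 / (2 * t) * ∫ x, w x * exp (g x) ∂ν := by
  have hint : ∀ {φ : EuclideanSpace ℝ (Fin n) → ℝ}, Continuous φ → Integrable φ ν :=
    fun hφ => hφ.integrable_of_ae_norm_le hR
  set A := ∫ x, exp (g x) ∂ν with hAdef
  set E := ∫ x, g x * exp (g x) ∂ν with hE
  set W := ∫ x, w x * exp (g x) ∂ν with hW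
  have hApos : 0 < A := by
    have : NeZero ν := ⟨fun h => by simp [h] at hA⟩
    exact integral_exp_pos (hint (by fun_prop))
  obtain ⟨K, hK⟩ := (isCompact_closedBall (0 : EuclideanSpace ℝ (Fin n)) R).exists_bound_of_continuousOn
    hw.continuousOn
  have hK' : ∀ᵐ x ∂ν, w x ≤ max K 1 := hR.mono fun x hx =>
    (le_abs_self _).trans ((hK x (by simpa using hx)).trans (le_max_left _ _))
  set L := max K 1 with hL
  have hL1 : 1 ≤ L := le_max_right _ _
  set C := (L * M / t ^ 2 + (L / t) ^ 2) * A with hC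
  set Φ : ℝ → ℝ := fun δ => (1 + δ) * log (A + δ * (1 / (2 * t) * W) + C * δ ^ 2)
    - log (A + δ * E) - δ * log Q with hΦ
  have hder : HasDerivAt Φ (log A + (1 / (2 * t) * W) / A - E / A - log Q) 0 := by
    have d1 : HasDerivAt (fun δ : ℝ => A + δ * (1 / (2 * t) * W) + C * δ ^ 2)
        (1 / (2 * t) * W) 0 := by
      have := (((hasDerivAt_id' (0 : ℝ)).mul_const (1 / (2 * t) * W)).const_add A).add
        (((hasDerivAt_id' (0 : ℝ)).pow 2).const_mul C)
      exact this.congr_deriv (by simp)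
    have d2 : HasDerivAt (fun δ : ℝ => A + δ * E) E 0 := by
      have := ((hasDerivAt_id' (0 : ℝ)).mul_const E).const_add A
      exact this.congr_deriv (by simp)
    have d3 := (((hasDerivAt_id' (0 : ℝ)).const_add 1).mul
      (d1.log (by simp [hApos.ne']))).sub (d2.log (by simp [hApos.ne']))
    have d4 := d3.sub ((hasDerivAt_id' (0 : ℝ)).mul_const (log Q))
    exact d4.congr_deriv (by simp)
  have hΦ0 : Φ 0 = 0 := by simp [hΦ]
  have hsmall : ∃ δ₀ : ℝ, 0 < δ₀ ∧ ∀ δ, 0 < δ → δ < δ₀ →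
      (M * δ ≤ t / 2 ∧ δ * L ≤ t) ∧ 0 < A + δ * E := by
    refine ⟨min (min (t / (2 * M)) (t / L)) (A / (|E| + 1)), by positivity, fun δ h0 h1 => ?_⟩
    simp only [lt_min_iff] at h1
    obtain ⟨⟨h2, h3⟩, h4⟩ := h1
    rw [lt_div_iff₀ (by positivity)] at h2 h3 h4
    refine ⟨⟨by linarith, h3.le⟩, ?_⟩
    nlinarith [neg_abs_le E]
  obtain ⟨δ₀, hδ₀, hs⟩ := hsmall
  have hfin := le_of_hasDerivAt_of_nonneg_right hder hΦ0 hδ₀ fun δ h0 h1 => by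
    obtain ⟨⟨hs1, hs2⟩, hs3⟩ := hs δ h0 h1
    have hmain := h δ h0 (by linarith)
    have hlow : A + δ * E ≤ ∫ x, exp ((1 + δ) * g x) ∂ν := by
      rw [hAdef, hE, ← integral_const_mul, ← integral_add (hint (by fun_prop)) (hint (by fun_prop))]
      refine integral_mono (hint (by fun_prop)) (hint (by fun_prop)) fun x => ?_
      have e : exp ((1 + δ) * g x) = exp (g x) * exp (δ * g x) := by rw [← exp_add]; ring_nf
      simp only [e]
      nlinarith [exp_pos (g x), add_one_le_exp (δ * g x)]
    have hup : ∫ x, exp (g x + δ * w x / (2 * (t - M * δ))) ∂ν ≤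
        A + δ * (1 / (2 * t) * W) + C * δ ^ 2 := by
      have e : A + δ * (1 / (2 * t) * W) + C * δ ^ 2 =
          ∫ x, (exp (g x) + δ * (1 / (2 * t)) * (w x * exp (g x))
            + ((L * M / t ^ 2 + (L / t) ^ 2) * δ ^ 2) * exp (g x)) ∂ν := by
        rw [integral_add (hint (by fun_prop)) (hint (by fun_prop)),
          integral_add (hint (by fun_prop)) (hint (by fun_prop)), integral_const_mul,
          integral_const_mul, ← hAdef, ← hW, hC]
        ring
      rw [e]
      refine integral_mono_ae (hint (by fun_prop)) (hint (by fun_prop)) ?_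
      filter_upwards [hK'] with x hx
      exact exp_add_div_le ht hM h0 hL1 (hw0 x) hx hs1 hs2
    have hlogl := log_le_log hs3 hlow
    have hpos : 0 < ∫ x, exp (g x + δ * w x / (2 * (t - M * δ))) ∂ν := by
      have : NeZero ν := ⟨fun h => by simp [h] at hA⟩
      exact integral_exp_pos (hint (by fun_prop))
    have hlogu := log_le_log hpos hup
    have : (1 + δ) * log (∫ x, exp (g x + δ * w x / (2 * (t - M * δ))) ∂ν) ≤
        (1 + δ) * log (A + δ * (1 / (2 * t) * W) + C * δ ^ 2) := by gcongr
    simp only [hΦ]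
    linarith
  have e : A * (log A + (1 / (2 * t) * W) / A - E / A - log Q) =
      A * log A + 1 / (2 * t) * W - E - A * log Q := by field_simp
  nlinarith [mul_nonneg hApos.le hfin]

/-- The entropy functional of `φ` with respect to the (unnormalized) finite measure `ν`. -/
noncomputable def entropyFunctional {α : Type*} [MeasurableSpace α] (ν : Measure α) (φ : α → ℝ) : ℝ :=
  ∫ x, φ x * log (φ x) ∂ν - (∫ x, φ x ∂ν) * (log (∫ x, φ x ∂ν) - log (ν.real Set.univ))

theorem strongly_logconcave_gradient_bound {δ t M G d a b : ℝ} (hδ : 0 < δ) (hM : M * δ < t)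
    (hab : a ≤ b + G * d + M / 2 * d ^ 2) :
    a - t * (d ^ 2 / δ) / 2 ≤ b + δ * G ^ 2 / (2 * (t - M * δ)) := by
  obtain ⟨s, hs⟩ : ∃ s, s = t - M * δ := ⟨_, rfl⟩
  have hs0 : 0 < s := by linarith
  have ht : t = s + M * δ := by linarith
  rw [← hs, ht]
  have h1 : G * d - s * d ^ 2 / (2 * δ) ≤ δ * G ^ 2 / (2 * s) := by
    rw [sub_le_iff_le_add, div_add_div _ _ (by positivity) (by positivity), le_div_iff₀ (by positivity)]
    nlinarith [sq_nonneg (δ * G - s * d)]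
  have h2 : (s + M * δ) * (d ^ 2 / δ) / 2 = s * d ^ 2 / (2 * δ) + M / 2 * d ^ 2 := by
    field_simp
  linarith

theorem entropy_exp_le_of_strongly_logconcave {n : ℕ} {q : EuclideanSpace ℝ (Fin n) → ℝ}
    (hqm : Measurable q) (hq0 : ∀ x, 0 ≤ q x) {t R : ℝ} (ht : 0 < t)
    (hq : ∀ x y : EuclideanSpace ℝ (Fin n), ∀ l : ℝ, 0 < l → l < 1 →
      q x ^ l * q y ^ (1 - l) * exp (t * (l * (1 - l) * ‖x - y‖ ^ 2) / 2) ≤ q (l • x + (1 - l) • y))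
    (hR : ∀ x, 0 < q x → ‖x‖ ≤ R) {ν : Measure (EuclideanSpace ℝ (Fin n))} [IsFiniteMeasure ν]
    (hν : ν = volume.withDensity fun x => ENNReal.ofReal (q x)) (hν0 : 0 < ν Set.univ)
    {g : EuclideanSpace ℝ (Fin n) → ℝ} (hg : ContDiff ℝ (⊤ : ℕ∞) g) :
    entropyFunctional ν (fun x => exp (g x)) ≤ 1 / (2 * t) * ∫ x, ‖gradient g x‖ ^ 2 * exp (g x) ∂ν := by
  obtain ⟨M, hM, hT⟩ := exists_le_add_inner_gradient_add hg R
  have hRν : ∀ᵐ x ∂ν, ‖x‖ ≤ R := by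
    rw [hν, ae_withDensity_iff (by fun_prop)]
    refine ae_of_all _ fun x hx => hR x ?_
    contrapose! hx
    simpa using hx
  have hcg := hg.continuous
  have hcg' := hg.continuous_gradient'
  have hlint : ∀ φ : EuclideanSpace ℝ (Fin n) → ℝ, Continuous φ → (∀ x, 0 ≤ φ x) →
      ∫⁻ x, ENNReal.ofReal (q x) * ENNReal.ofReal (φ x) = ENNReal.ofReal (∫ x, φ x ∂ν) := by
    intro φ hφ hφ0
    rw [ofReal_integral_eq_lintegral_ofReal (hφ.integrable_of_ae_norm_le hRν) (ae_of_all _ hφ0), hν,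
      lintegral_withDensity_eq_lintegral_mul _ (by fun_prop) (by fun_prop)]
    rfl
  have : NeZero ν := ⟨fun h => by simp [h] at hν0⟩
  have hpos : ∀ φ : EuclideanSpace ℝ (Fin n) → ℝ, Continuous φ → 0 < ∫ x, exp (φ x) ∂ν :=
    fun φ hφ => integral_exp_pos ((continuous_exp.comp hφ).integrable_of_ae_norm_le hRν)
  simp only [entropyFunctional, log_exp]
  simp_rw [mul_comm (exp _) (g _)]
  refine entropy_exp_le_of_forall_small hRν hν0 ht hM hcg (by fun_prop) (fun x => by positivity) ?_
  intro δ hδ hδM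
  have hl0 : 0 < 1 / (1 + δ) := by positivity
  have hl1 : 1 / (1 + δ) < 1 := by rw [div_lt_one (by positivity)]; linarith
  have h1l : 1 - 1 / (1 + δ) = δ / (1 + δ) := by field_simp; ring
  have key := prekopa_leindler hl0 hl1
    (u := fun x => ENNReal.ofReal (q x) * ENNReal.ofReal (exp ((1 + δ) * g x)))
    (v := fun x => ENNReal.ofReal (q x) * ENNReal.ofReal (exp 0))
    (w := fun x => ENNReal.ofReal (q x) *
      ENNReal.ofReal (exp (g x + δ * ‖gradient g x‖ ^ 2 / (2 * (t - M * δ)))))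
    (by fun_prop) (by fun_prop) (by fun_prop) ?_
  · rw [hlint _ (by fun_prop) (fun x => by positivity), hlint _ (by fun_prop) (fun x => by positivity),
      hlint _ (by fun_prop) (fun x => by positivity),
      ENNReal.ofReal_rpow_of_pos (hpos _ (by fun_prop)), ENNReal.ofReal_rpow_of_pos (hpos _ (by fun_prop)),
      ← ENNReal.ofReal_mul (by have := hpos (fun x => (1 + δ) * g x) (by fun_prop); positivity),
      ENNReal.ofReal_le_ofReal_iff (hpos _ (by fun_prop)).le] at key
    have hU := hpos (fun x => (1 + δ) * g x) (by fun_prop)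
    have hQ := hpos (fun x => 0) (by fun_prop)
    have := log_le_log (by positivity) key
    rw [log_mul (by positivity) (by positivity), log_rpow hU, log_rpow hQ, h1l] at this
    simp only [exp_zero, integral_const, smul_eq_mul, mul_one] at this
    have h3 := mul_le_mul_of_nonneg_left this (show 0 ≤ 1 + δ by positivity)
    refine le_trans (le_of_eq ?_) h3
    field_simp
  · intro x y
    rw [← ENNReal.ofReal_mul (hq0 _), ← ENNReal.ofReal_mul (hq0 _), ← ENNReal.ofReal_mul (hq0 _),
      ENNReal.ofReal_rpow_of_nonneg (by have := hq0 x; positivity) hl0.le,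
      ENNReal.ofReal_rpow_of_nonneg (by have := hq0 y; positivity) (by linarith),
      ← ENNReal.ofReal_mul (by have := hq0 x; positivity)]
    refine ENNReal.ofReal_le_ofReal ?_
    rw [mul_rpow (hq0 _) (exp_pos _).le, exp_zero, mul_one, ← exp_mul]
    set l := 1 / (1 + δ) with hl
    set z := l • x + (1 - l) • y with hz
    rcases (hq0 x).eq_or_lt with hx | hx
    · rw [← hx, zero_rpow hl0.ne']
      have := hq0 z
      simp only [zero_mul]
      positivity
    rcases (hq0 y).eq_or_lt with hy | hy
    · rw [← hy, zero_rpow (by linarith)]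
      have := hq0 z
      simp only [mul_zero]
      positivity
    have hzR : ‖z‖ ≤ R := by
      have := (convex_closedBall (0 : EuclideanSpace ℝ (Fin n)) R) (x := x) (y := y)
        (by simpa using hR x hx) (by simpa using hR y hy) hl0.le (by linarith : 0 ≤ 1 - l) (by ring)
      simpa using this
    have h1 := hT x z (hR x hx) hzR
    have hxz : ‖x - z‖ = (1 - l) * ‖x - y‖ := by
      have : x - z = (1 - l) • (x - y) := by rw [hz]; module
      rw [this, norm_smul, Real.norm_of_nonneg (by linarith)]
    have h2 := strongly_logconcave_gradient_bound hδ hδM h1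
    have h3 : ‖x - z‖ ^ 2 / δ = l * (1 - l) * ‖x - y‖ ^ 2 := by
      rw [hxz, h1l, hl]; field_simp
    rw [h3] at h2
    have h4 : (1 + δ) * g x * l = g x := by rw [hl]; field_simp
    rw [h4]
    have h5 := hq x y l hl0 hl1
    calc q x ^ l * exp (g x) * q y ^ (1 - l)
        = q x ^ l * q y ^ (1 - l) * exp (t * (l * (1 - l) * ‖x - y‖ ^ 2) / 2) *
          exp (g x - t * (l * (1 - l) * ‖x - y‖ ^ 2) / 2) := by
          rw [mul_assoc (q x ^ l * q y ^ (1 - l)), ← exp_add]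
          ring_nf
      _ ≤ q z * exp (g x - t * (l * (1 - l) * ‖x - y‖ ^ 2) / 2) := by gcongr
      _ ≤ _ := by
        have := hq0 z
        gcongr

theorem norm_gradient_log_sq_add_sq_mul_le {n : ℕ} {f : EuclideanSpace ℝ (Fin n) → ℝ}
    (hf : ContDiff ℝ (⊤ : ℕ∞) f) {ε : ℝ} (hε : 0 < ε) (x : EuclideanSpace ℝ (Fin n)) :
    ‖gradient (fun x => log (f x ^ 2 + ε)) x‖ ^ 2 * exp (log (f x ^ 2 + ε)) ≤
      4 * ‖gradient f x‖ ^ 2 := by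
  have hp : 0 < f x ^ 2 + ε := by positivity
  have hd : HasFDerivAt f (fderiv ℝ f x) x := (hf.differentiable (by simp) x).hasFDerivAt
  have h1 := ((hd.pow 2).add_const ε).log hp.ne'
  have e : gradient (fun x => log (f x ^ 2 + ε)) x =
      (2 * f x / (f x ^ 2 + ε)) • gradient f x := by
    unfold gradient
    rw [h1.fderiv]
    simp [smul_smul]
    congr 1
    ring
  rw [e, norm_smul, exp_log hp, mul_pow, Real.norm_eq_abs, sq_abs, div_pow]
  have h2 : (2 * f x) ^ 2 / (f x ^ 2 + ε) ^ 2 * (f x ^ 2 + ε) ≤ 4 := by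
    rw [div_mul_eq_mul_div, div_le_iff₀ (by positivity)]
    nlinarith [sq_nonneg (f x)]
  nlinarith [sq_nonneg ‖gradient f x‖]

theorem mul_log_add_mul_log_le {x ε : ℝ} (hx : 0 ≤ x) (hε : 0 < ε) :
    x * log x + ε * log ε ≤ (x + ε) * log (x + ε) := by
  rcases hx.eq_or_lt with rfl | hx
  · simp
  have h1 : log x ≤ log (x + ε) := log_le_log hx (by linarith)
  have h2 : log ε ≤ log (x + ε) := log_le_log hε (by linarith)
  nlinarith

theorem continuous_sq_mul_log_sq {X : Type*} [TopologicalSpace X] {f : X → ℝ} (hf : Continuous f) :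
    Continuous fun x => f x ^ 2 * log (f x ^ 2) :=
  continuous_mul_log.comp (hf.pow 2)

/-- A logarithmic Sobolev inequality for exponentials extends to squares. -/
theorem entropy_sq_le_of_forall_exp {n : ℕ} {ν : Measure (EuclideanSpace ℝ (Fin n))}
    [IsFiniteMeasure ν] {R t : ℝ} (ht : 0 < t) (hR : ∀ᵐ x ∂ν, ‖x‖ ≤ R)
    (H : ∀ g : EuclideanSpace ℝ (Fin n) → ℝ, ContDiff ℝ (⊤ : ℕ∞) g →
      entropyFunctional ν (fun x => exp (g x)) ≤
        1 / (2 * t) * ∫ x, ‖gradient g x‖ ^ 2 * exp (g x) ∂ν)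
    {f : EuclideanSpace ℝ (Fin n) → ℝ} (hf : ContDiff ℝ (⊤ : ℕ∞) f) :
    entropyFunctional ν (fun x => f x ^ 2) ≤ 2 / t * ∫ x, ‖gradient f x‖ ^ 2 ∂ν := by
  have hint : ∀ {φ : EuclideanSpace ℝ (Fin n) → ℝ}, Continuous φ → Integrable φ ν :=
    fun hφ => hφ.integrable_of_ae_norm_le hR
  have hfc := hf.continuous
  have hfg := hf.continuous_gradient'
  have hflog := continuous_sq_mul_log_sq hfc
  set Q := ν.real Set.univ with hQ
  set A := ∫ x, f x ^ 2 ∂ν with hA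
  have hlim : Tendsto (fun ε : ℝ => ∫ x, f x ^ 2 * log (f x ^ 2) ∂ν + ε * log ε * Q
      - ((A + ε * Q) * log (A + ε * Q) - (A + ε * Q) * log Q)) (𝓝[>] 0)
      (𝓝 (entropyFunctional ν (fun x => f x ^ 2))) := by
    have c1 : Continuous fun ε : ℝ => ε * log ε := continuous_mul_log
    have c2 : Continuous fun ε : ℝ => (A + ε * Q) * log (A + ε * Q) :=
      continuous_mul_log.comp (by fun_prop)
    have c3 : Continuous (fun ε : ℝ => ∫ x, f x ^ 2 * log (f x ^ 2) ∂ν + ε * log ε * Q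
      - ((A + ε * Q) * log (A + ε * Q) - (A + ε * Q) * log Q)) := by fun_prop
    have := (c3.tendsto 0).mono_left (nhdsWithin_le_nhds (s := Set.Ioi 0))
    convert this using 2
    simp [entropyFunctional, ← hA, ← hQ]
    ring
  refine le_of_tendsto hlim ?_
  filter_upwards [self_mem_nhdsWithin] with ε hε
  have hε : 0 < ε := hε
  have hgs : ContDiff ℝ (⊤ : ℕ∞) fun x => log (f x ^ 2 + ε) :=
    ((hf.pow 2).add contDiff_const).log fun x => by positivity
  have h1 := H _ hgs
  have he : ∀ x, exp (log (f x ^ 2 + ε)) = f x ^ 2 + ε := fun x => exp_log (by positivity)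
  have h2 : ∫ x, ‖gradient (fun x => log (f x ^ 2 + ε)) x‖ ^ 2 * exp (log (f x ^ 2 + ε)) ∂ν ≤
      4 * ∫ x, ‖gradient f x‖ ^ 2 ∂ν := by
    rw [← integral_const_mul]
    refine integral_mono (hint ?_) (hint (by fun_prop)) fun x =>
      norm_gradient_log_sq_add_sq_mul_le hf hε x
    have := hgs.continuous_gradient'
    have := hgs.continuous
    fun_prop
  have h3 : 1 / (2 * t) * (4 * ∫ x, ‖gradient f x‖ ^ 2 ∂ν) = 2 / t * ∫ x, ‖gradient f x‖ ^ 2 ∂ν := by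
    field_simp; ring
  refine le_trans ?_ (h1.trans ((mul_le_mul_of_nonneg_left h2 (by positivity)).trans h3.le))
  simp only [he, entropyFunctional]
  have e1 : ∫ x, (f x ^ 2 + ε) ∂ν = A + ε * Q := by
    rw [integral_add (hint (by fun_prop)) (hint (by fun_prop))]
    simp [hA, hQ, mul_comm]
  have e2 : ∫ x, f x ^ 2 * log (f x ^ 2) ∂ν + ε * log ε * Q ≤
      ∫ x, (f x ^ 2 + ε) * log (f x ^ 2 + ε) ∂ν := by
    have : ε * log ε * Q = ∫ x, ε * log ε ∂ν := by simp [hQ, mul_comm]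
    rw [this, ← integral_add (hint hflog) (hint (by fun_prop))]
    exact integral_mono (hint (hflog.add continuous_const))
      (hint (continuous_mul_log.comp (by fun_prop)))
      fun x => mul_log_add_mul_log_le (sq_nonneg _) hε
  rw [e1, ← hQ]
  linarith

theorem two_mul_sq_sub_le_sq_mul_log {x m : ℝ} (hx : 0 < x) (hm : 0 < m) :
    2 * x ^ 2 - 2 * m * x ≤ x ^ 2 * (log (x ^ 2) - log (m ^ 2)) := by
  have h := one_sub_inv_le_log_of_pos (div_pos hx hm)
  rw [log_div hx.ne' hm.ne'] at h
  rw [log_pow, log_pow]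
  push_cast
  have h2 := mul_le_mul_of_nonneg_left h (by positivity : 0 ≤ 2 * x ^ 2)
  have h3 : 2 * x ^ 2 * (1 - (x / m)⁻¹) = 2 * x ^ 2 - 2 * m * x := by field_simp
  linarith

/-- The logarithmic Sobolev inequality implies the Poincaré inequality. -/
theorem poincare_of_forall_entropy_sq_le {n : ℕ} {ν : Measure (EuclideanSpace ℝ (Fin n))}
    [IsFiniteMeasure ν] {R t : ℝ} (hν : 0 < ν Set.univ) (hR : ∀ᵐ x ∂ν, ‖x‖ ≤ R)
    (H : ∀ f : EuclideanSpace ℝ (Fin n) → ℝ, ContDiff ℝ (⊤ : ℕ∞) f →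
      entropyFunctional ν (fun x => f x ^ 2) ≤ 2 / t * ∫ x, ‖gradient f x‖ ^ 2 ∂ν)
    {f : EuclideanSpace ℝ (Fin n) → ℝ} (hf : ContDiff ℝ (⊤ : ℕ∞) f) :
    ∫ x, f x ^ 2 ∂ν - (∫ x, f x ∂ν) ^ 2 / ν.real Set.univ ≤ 2 / t * ∫ x, ‖gradient f x‖ ^ 2 ∂ν := by
  have hint : ∀ {φ : EuclideanSpace ℝ (Fin n) → ℝ}, Continuous φ → Integrable φ ν :=
    fun hφ => hφ.integrable_of_ae_norm_le hR
  have hfc := hf.continuous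
  obtain ⟨K, hK⟩ := (isCompact_closedBall (0 : EuclideanSpace ℝ (Fin n)) R).exists_bound_of_continuousOn
    hfc.continuousOn
  set F := fun x => f x + (K + 1) with hF
  have hFs : ContDiff ℝ (⊤ : ℕ∞) F := hf.add contDiff_const
  have hFc : Continuous F := hFs.continuous
  have hgrad : ∀ x, gradient F x = gradient f x := fun x => by
    simp [gradient, hF, fderiv_add_const]
  have hF1 : ∀ᵐ x ∂ν, 1 ≤ F x := hR.mono fun x hx => by
    have := (abs_le.1 (hK x (by simpa using hx))).1
    simp only [hF]; linarith
  have h1 := H F hFs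
  simp only [hgrad] at h1
  set Q := ν.real Set.univ with hQ
  have hQ0 : 0 < Q := ENNReal.toReal_pos hν.ne' (measure_ne_top _ _)
  have hA : Q ≤ ∫ x, F x ^ 2 ∂ν := by
    have : ∫ x, (1 : ℝ) ∂ν ≤ ∫ x, F x ^ 2 ∂ν :=
      integral_mono_ae (hint continuous_const) (hint (by fun_prop)) (hF1.mono fun x hx => by
        simp only; nlinarith)
    simpa [hQ] using this
  set A := ∫ x, F x ^ 2 ∂ν with hA'
  set B := ∫ x, F x ∂ν with hB
  have hA0 : 0 < A := hQ0.trans_le hA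
  set m := √(A / Q) with hm
  have hm0 : 0 < m := sqrt_pos.2 (by positivity)
  have hm2 : m ^ 2 = A / Q := sq_sqrt (by positivity)
  have h2 : 2 * A - 2 * m * B ≤ entropyFunctional ν (fun x => F x ^ 2) := by
    have e1 : 2 * A - 2 * m * B = ∫ x, (2 * F x ^ 2 - 2 * m * F x) ∂ν := by
      rw [integral_sub (hint (by fun_prop)) (hint (by fun_prop)), integral_const_mul,
        integral_const_mul]
    have e2 : entropyFunctional ν (fun x => F x ^ 2) =
        ∫ x, (F x ^ 2 * log (F x ^ 2) - F x ^ 2 * log (m ^ 2)) ∂ν := by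
      rw [integral_sub (hint (continuous_sq_mul_log_sq hFc)) (hint (by fun_prop)),
        integral_mul_const, hm2, log_div hA0.ne' hQ0.ne']
      rfl
    rw [e1, e2]
    refine integral_mono_ae (hint (by fun_prop))
      (hint ((continuous_sq_mul_log_sq hFc).sub (by fun_prop))) (hF1.mono fun x hx => ?_)
    have := two_mul_sq_sub_le_sq_mul_log (zero_lt_one.trans_le hx) hm0
    simp only
    linarith
  have hAm : A = m ^ 2 * Q := by rw [hm2]; field_simp
  have h3 : A - B ^ 2 / Q ≤ 2 * A - 2 * m * B := by
    have : 0 ≤ (m * Q - B) ^ 2 / Q := by positivity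
    have e : (m * Q - B) ^ 2 / Q = m ^ 2 * Q - 2 * m * B + B ^ 2 / Q := by field_simp; ring
    linarith
  have eB : B = ∫ x, f x ∂ν + (K + 1) * Q := by
    rw [hB, integral_add (hint (by fun_prop)) (hint (by fun_prop))]
    simp [hQ, mul_comm]
  have eA : A = ∫ x, f x ^ 2 ∂ν + 2 * (K + 1) * ∫ x, f x ∂ν + (K + 1) ^ 2 * Q := by
    have : ∀ x, F x ^ 2 = f x ^ 2 + 2 * (K + 1) * f x + (K + 1) ^ 2 := fun x => by
      simp only [hF]; ring
    rw [hA']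
    simp_rw [this]
    rw [integral_add (hint (by fun_prop)) (hint (by fun_prop)),
      integral_add (hint (by fun_prop)) (hint (by fun_prop)), integral_const_mul]
    simp [hQ, mul_comm]
  have e : A - B ^ 2 / Q = ∫ x, f x ^ 2 ∂ν - (∫ x, f x ∂ν) ^ 2 / Q := by
    rw [eA, eB]; field_simp; ring
  linarith

/-- Lower bound on the entropy by duality, for a reference measure of mass at least `1/2`. -/
theorem integral_le_entropy_sq {n : ℕ} {ν : Measure (EuclideanSpace ℝ (Fin n))}
    [IsFiniteMeasure ν] {R : ℝ} (hR : ∀ᵐ x ∂ν, ‖x‖ ≤ R) (hν : 1 / 2 ≤ ν.real Set.univ)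
    {f b : EuclideanSpace ℝ (Fin n) → ℝ} (hf : Continuous f) (hb : Continuous b)
    (hb0 : ∀ x, 0 < b x) :
    ∫ x, f x ^ 2 * (log (f x ^ 2) - log (b x) - (∫ y, f y ^ 2 ∂ν) / b x + 1 - log 2) ∂ν ≤
      entropyFunctional ν (fun x => f x ^ 2) := by
  have hint : ∀ {φ : EuclideanSpace ℝ (Fin n) → ℝ}, Continuous φ → Integrable φ ν :=
    fun hφ => hφ.integrable_of_ae_norm_le hR
  have hflog := continuous_sq_mul_log_sq hf
  have hblog : Continuous fun x => log (b x) := hb.log fun x => (hb0 x).ne'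
  have hbinv : Continuous fun x => (b x)⁻¹ := hb.inv₀ fun x => (hb0 x).ne'
  set A := ∫ y, f y ^ 2 ∂ν with hA
  set Q := ν.real Set.univ with hQ
  have e : entropyFunctional ν (fun x => f x ^ 2) =
      ∫ x, (f x ^ 2 * log (f x ^ 2) - f x ^ 2 * (log A - log Q)) ∂ν := by
    rw [integral_sub (hint hflog) (hint (by fun_prop)), integral_mul_const]
    rfl
  have hcont : Continuous fun x =>
      f x ^ 2 * (log (f x ^ 2) - log (b x) - A / b x + 1 - log 2) := by
    have : (fun x => f x ^ 2 * (log (f x ^ 2) - log (b x) - A / b x + 1 - log 2)) =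
      fun x => f x ^ 2 * log (f x ^ 2) + f x ^ 2 * (- log (b x) - A * (b x)⁻¹ + 1 - log 2) := by
      ext x; ring
    rw [this]
    fun_prop
  rw [e]
  rcases (integral_nonneg (fun x => sq_nonneg (f x)) : 0 ≤ A).eq_or_lt with h0 | h0
  · have h1 : (fun x => f x ^ 2) =ᵐ[ν] 0 :=
      (integral_eq_zero_iff_of_nonneg (fun x => sq_nonneg (f x)) (hint (by fun_prop))).1 h0.symm
    refine le_of_eq (integral_congr_ae (h1.mono fun x hx => ?_))
    have hx : f x ^ 2 = 0 := hx
    simp [hx]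
  · refine integral_mono (hint hcont) (hint (hflog.sub (by fun_prop))) fun x => ?_
    have hbx := hb0 x
    have h1 := log_le_sub_one_of_pos (div_pos h0 hbx)
    rw [log_div h0.ne' hbx.ne'] at h1
    have h2 : log (1 / 2) ≤ log Q := log_le_log (by norm_num) hν
    rw [one_div, log_inv] at h2
    simp only
    rw [← mul_sub]
    exact mul_le_mul_of_nonneg_left (by linarith) (sq_nonneg _)

/-- `μ` is an isotropic logconcave probability measure with measurable density `p`, supported in
the ball of radius `D`. -/
structure IsotropicLogConcaveOn {n : ℕ} (μ : Measure (EuclideanSpace ℝ (Fin n)))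
    (p : EuclideanSpace ℝ (Fin n) → ℝ) (D : ℝ) : Prop where
  measurable : Measurable p
  nonneg : ∀ x, 0 ≤ p x
  logconcave : ∀ x y : EuclideanSpace ℝ (Fin n), ∀ l : ℝ, 0 < l → l < 1 →
    p x ^ l * p y ^ (1 - l) ≤ p (l • x + (1 - l) • y)
  norm_le : ∀ x, 0 < p x → ‖x‖ ≤ D
  eq_withDensity : μ = volume.withDensity fun x => ENNReal.ofReal (p x)
  prob : IsProbabilityMeasure μ
  integral_inner : ∀ v, ∫ x, ⟪v, x⟫_ℝ ∂μ = 0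
  integral_inner_sq : ∀ v, ∫ x, ⟪v, x⟫_ℝ ^ 2 ∂μ = ‖v‖ ^ 2

namespace IsotropicLogConcaveOn

variable {n : ℕ} {μ : Measure (EuclideanSpace ℝ (Fin n))}
  {p : EuclideanSpace ℝ (Fin n) → ℝ} {D : ℝ}

theorem ae_norm_le (h : IsotropicLogConcaveOn μ p D) : ∀ᵐ x ∂μ, ‖x‖ ≤ D := by
  have := h.measurable
  rw [h.eq_withDensity, ae_withDensity_iff (by fun_prop)]
  refine ae_of_all _ fun x hx => h.norm_le x ?_
  contrapose! hx
  simpa using hx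

theorem measure_rpow_mul_le (h : IsotropicLogConcaveOn μ p D)
    {S T U : Set (EuclideanSpace ℝ (Fin n))} (hS : MeasurableSet S) (hT : MeasurableSet T)
    (hU : MeasurableSet U) {l : ℝ} (h0 : 0 < l) (h1 : l < 1)
    (hSTU : ∀ x ∈ S, ∀ y ∈ T, l • x + (1 - l) • y ∈ U) :
    μ S ^ l * μ T ^ (1 - l) ≤ μ U := by
  have hp := h.measurable
  have hm : ∀ A, MeasurableSet A → μ A = ∫⁻ x, A.indicator (fun x => ENNReal.ofReal (p x)) x := by
    intro A hA
    rw [h.eq_withDensity, withDensity_apply _ hA, lintegral_indicator hA]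
  rw [hm S hS, hm T hT, hm U hU]
  refine prekopa_leindler h0 h1 (Measurable.indicator (by fun_prop) hS)
    (Measurable.indicator (by fun_prop) hT) (Measurable.indicator (by fun_prop) hU) fun x y => ?_
  by_cases hx : x ∈ S
  · by_cases hy : y ∈ T
    · rw [Set.indicator_of_mem hx, Set.indicator_of_mem hy,
        Set.indicator_of_mem (hSTU x hx y hy), ENNReal.ofReal_rpow_of_nonneg (h.nonneg x) h0.le,
        ENNReal.ofReal_rpow_of_nonneg (h.nonneg y) (by linarith),
        ← ENNReal.ofReal_mul (rpow_nonneg (h.nonneg x) _)]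
      exact ENNReal.ofReal_le_ofReal (h.logconcave x y l h0 h1)
    · rw [Set.indicator_of_notMem hy, ENNReal.zero_rpow_of_pos (by linarith)]
      simp
  · rw [Set.indicator_of_notMem hx, ENNReal.zero_rpow_of_pos h0]
    simp

theorem integrable (h : IsotropicLogConcaveOn μ p D) {φ : EuclideanSpace ℝ (Fin n) → ℝ}
    (hφ : Continuous φ) : Integrable φ μ :=
  have := h.prob
  hφ.integrable_of_ae_norm_le h.ae_norm_le

theorem measureReal_two_le_abs_inner (h : IsotropicLogConcaveOn μ p D)
    {v : EuclideanSpace ℝ (Fin n)} (hv : ‖v‖ ≤ 1) : μ.real {x | 2 ≤ |⟪v, x⟫_ℝ|} ≤ 1 / 4 := by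
  have := h.prob
  have h1 := mul_meas_ge_le_integral_of_nonneg (μ := μ) (f := fun x => ⟪v, x⟫_ℝ ^ 2)
    (ae_of_all _ fun x => sq_nonneg _) (h.integrable (by fun_prop)) 4
  rw [h.integral_inner_sq] at h1
  have h2 : {x | 2 ≤ |⟪v, x⟫_ℝ|} = {x | 4 ≤ ⟪v, x⟫_ℝ ^ 2} := by
    ext x
    simp only [Set.mem_ofPred_eq]
    rw [← sq_abs ⟪v, x⟫_ℝ]
    constructor <;> intro h
    · nlinarith
    · nlinarith [abs_nonneg ⟪v, x⟫_ℝ]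
  rw [h2]
  nlinarith [norm_nonneg v]

theorem measureReal_tail_le (h : IsotropicLogConcaveOn μ p D)
    {v : EuclideanSpace ℝ (Fin n)} (hv : ‖v‖ ≤ 1) (j : ℕ) :
    μ.real {x | 4 * ((j : ℝ) + 1) - 2 ≤ ⟪v, x⟫_ℝ} ≤ (1 / 3) ^ (j + 1) := by
  have := h.prob
  have hms : ∀ c : ℝ, MeasurableSet {x : EuclideanSpace ℝ (Fin n) | c ≤ ⟪v, x⟫_ℝ} := fun c =>
    measurableSet_le (by fun_prop) (by fun_prop)
  have hfar : μ.real {x | 2 ≤ ⟪v, x⟫_ℝ} ≤ 1 / 4 :=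
    (measureReal_mono fun x (hx : 2 ≤ ⟪v, x⟫_ℝ) => (hx.trans (le_abs_self _) : 2 ≤ |⟪v, x⟫_ℝ|)).trans
      (h.measureReal_two_le_abs_inner hv)
  have hnear : 3 / 4 ≤ μ.real {x | -2 ≤ ⟪v, x⟫_ℝ} := by
    have h1 : μ.real {x | -2 ≤ ⟪v, x⟫_ℝ}ᶜ ≤ 1 / 4 := by
      refine (measureReal_mono fun x hx => ?_).trans (h.measureReal_two_le_abs_inner hv)
      simp only [Set.mem_compl_iff, Set.mem_ofPred_eq, not_le] at hx ⊢
      rw [le_abs]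
      right; linarith
    rw [measureReal_compl (hms _)] at h1
    simp at h1
    linarith
  rcases Nat.eq_zero_or_pos j with rfl | hj
  · norm_num at hfar ⊢
    linarith
  have hj' : (1 : ℝ) ≤ j := by exact_mod_cast hj
  set l : ℝ := 1 / (j + 1) with hl
  have hl0 : 0 < l := by positivity
  have hl1 : l < 1 := by rw [hl, div_lt_one (by positivity)]; linarith
  have key := h.measure_rpow_mul_le (hms (4 * (j + 1) - 2)) (hms (-2)) (hms 2) hl0 hl1 ?_
  · set a := μ.real {x | 4 * ((j : ℝ) + 1) - 2 ≤ ⟪v, x⟫_ℝ} with ha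
    set b := μ.real {x | -2 ≤ ⟪v, x⟫_ℝ} with hb
    have ha0 : 0 ≤ a := measureReal_nonneg
    have hb0 : 0 ≤ b := measureReal_nonneg
    have key2 := ENNReal.toReal_mono (measure_ne_top _ _) key
    rw [ENNReal.toReal_mul, ← ENNReal.toReal_rpow, ← ENNReal.toReal_rpow] at key2
    change a ^ l * b ^ (1 - l) ≤ μ.real _ at key2
    have key3 : a ^ l * (3 / 4 : ℝ) ^ (1 - l) ≤ 1 / 4 := by
      refine le_trans ?_ (key2.trans hfar)
      gcongr
    have key4 := pow_le_pow_left₀ (by positivity) key3 (j + 1)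
    rw [mul_pow, ← rpow_natCast, ← rpow_natCast (_ ^ (1 - l)), ← rpow_mul ha0,
      ← rpow_mul (by norm_num)] at key4
    have e1 : l * ((j + 1 : ℕ) : ℝ) = 1 := by push_cast; rw [hl]; field_simp
    have e2 : (1 - l) * ((j + 1 : ℕ) : ℝ) = j := by rw [sub_mul, e1]; push_cast; ring
    rw [e1, e2, rpow_one, rpow_natCast] at key4
    have e3 : (1 / 4 : ℝ) ^ (j + 1) = (1 / 3) ^ (j + 1) * (3 / 4) ^ (j + 1) := by
      rw [← mul_pow]; norm_num
    rw [e3, pow_succ (3 / 4 : ℝ)] at key4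
    have h34 : (0 : ℝ) < (3 / 4) ^ j := by positivity
    have h13 : (0 : ℝ) < (1 / 3) ^ (j + 1) := by positivity
    have : a * (3 / 4) ^ j ≤ (1 / 3) ^ (j + 1) * (3 / 4) ^ j := by
      nlinarith [mul_pos h13 h34]
    exact le_of_mul_le_mul_right this h34
  · intro x hx y hy
    simp only [Set.mem_ofPred_eq] at hx hy ⊢
    rw [inner_add_right, inner_smul_right, inner_smul_right]
    have e1 : l * (j + 1) = 1 := by rw [hl]; field_simp
    nlinarith [mul_le_mul_of_nonneg_left hx hl0.le, mul_le_mul_of_nonneg_left hy (by linarith : 0 ≤ 1 - l)]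

theorem ofReal_exp_div_eight_le (y : ℝ) : ENNReal.ofReal (exp (y / 8)) ≤
    2 + ∑' j : ℕ, ENNReal.ofReal (2 * 2 ^ (j + 1)) *
      {y : ℝ | 4 * ((j : ℝ) + 1) - 2 ≤ y}.indicator 1 y := by
  have he1 : exp (1 / 2) ≤ 2 := by
    have h1 := exp_one_lt_three
    have h2 : exp (1 / 2) ^ 2 = exp 1 := by rw [← exp_nat_mul]; norm_num
    nlinarith [exp_pos (1 / 2)]
  have he2 : exp (1 / 4) ≤ 2 := (exp_le_exp.2 (by norm_num)).trans he1
  rcases lt_or_ge y 2 with hy | hy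
  · have : exp (y / 8) ≤ 2 := (exp_le_exp.2 (by linarith)).trans he2
    calc ENNReal.ofReal (exp (y / 8)) ≤ ENNReal.ofReal 2 := ENNReal.ofReal_le_ofReal this
      _ = 2 := by simp
      _ ≤ _ := le_self_add
  · obtain ⟨j, hj⟩ : ∃ j : ℕ, ⌊(y + 2) / 4⌋₊ = j + 1 := by
      refine Nat.exists_eq_succ_of_ne_zero ?_
      rw [Nat.ne_zero_iff_zero_lt]
      exact Nat.floor_pos.2 (by linarith)
    have h1 := Nat.floor_le (show 0 ≤ (y + 2) / 4 by linarith)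
    have h2 := Nat.lt_floor_add_one ((y + 2) / 4)
    rw [hj] at h1 h2
    push_cast at h1 h2
    refine le_trans ?_ (le_add_left (ENNReal.le_tsum j))
    rw [Set.indicator_of_mem (by simp only [Set.mem_ofPred_eq]; linarith)]
    simp only [Pi.one_apply, mul_one]
    refine ENNReal.ofReal_le_ofReal ?_
    calc exp (y / 8) ≤ exp (1 / 4 + ((j + 1 : ℕ) : ℝ) * (1 / 2)) :=
          exp_le_exp.2 (by push_cast; linarith)
      _ = exp (1 / 4) * exp (1 / 2) ^ (j + 1) := by rw [exp_add, exp_nat_mul]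
      _ ≤ 2 * 2 ^ (j + 1) := by gcongr

theorem integral_exp_inner_div_eight_le (h : IsotropicLogConcaveOn μ p D)
    {v : EuclideanSpace ℝ (Fin n)} (hv : ‖v‖ ≤ 1) : ∫ x, exp (⟪v, x⟫_ℝ / 8) ∂μ ≤ 6 := by
  have := h.prob
  rw [integral_eq_lintegral_of_nonneg_ae (ae_of_all _ fun x => (exp_pos _).le) (by fun_prop)]
  refine ENNReal.toReal_le_of_le_ofReal (by norm_num) ?_
  have hms : ∀ c : ℝ, MeasurableSet {x : EuclideanSpace ℝ (Fin n) | c ≤ ⟪v, x⟫_ℝ} := fun c =>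
    measurableSet_le (by fun_prop) (by fun_prop)
  have hind : ∀ j : ℕ, (fun x : EuclideanSpace ℝ (Fin n) =>
      {y : ℝ | 4 * ((j : ℝ) + 1) - 2 ≤ y}.indicator (1 : ℝ → ℝ≥0∞) ⟪v, x⟫_ℝ) =
      {x : EuclideanSpace ℝ (Fin n) | 4 * ((j : ℝ) + 1) - 2 ≤ ⟪v, x⟫_ℝ}.indicator 1 := by
    intro j; ext x; rfl
  have hmi : ∀ j : ℕ, Measurable (fun x : EuclideanSpace ℝ (Fin n) =>
      {y : ℝ | 4 * ((j : ℝ) + 1) - 2 ≤ y}.indicator (1 : ℝ → ℝ≥0∞) ⟪v, x⟫_ℝ) := by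
    intro j
    rw [hind]
    exact measurable_one.indicator (hms _)
  have hsum : HasSum (fun j : ℕ => 2 * 2 ^ (j + 1) * (1 / 3 : ℝ) ^ (j + 1)) 4 := by
    have h1 := (hasSum_geometric_of_lt_one (r := (2 / 3 : ℝ)) (by norm_num) (by norm_num)).mul_left (4 / 3)
    have e : (fun j : ℕ => 2 * 2 ^ (j + 1) * (1 / 3 : ℝ) ^ (j + 1)) =
        fun j => 4 / 3 * (2 / 3) ^ j := by
      ext j
      rw [mul_assoc, ← mul_pow, pow_succ]
      norm_num; ring
    rw [e]
    norm_num at h1 ⊢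
    exact h1
  calc ∫⁻ x, ENNReal.ofReal (exp (⟪v, x⟫_ℝ / 8)) ∂μ
      ≤ ∫⁻ x, (2 + ∑' j : ℕ, ENNReal.ofReal (2 * 2 ^ (j + 1)) *
        {y : ℝ | 4 * ((j : ℝ) + 1) - 2 ≤ y}.indicator 1 ⟪v, x⟫_ℝ) ∂μ :=
        lintegral_mono fun x => ofReal_exp_div_eight_le _
    _ = 2 + ∑' j : ℕ, ENNReal.ofReal (2 * 2 ^ (j + 1)) *
        μ {x | 4 * ((j : ℝ) + 1) - 2 ≤ ⟪v, x⟫_ℝ} := by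
        rw [lintegral_add_left (by fun_prop), lintegral_tsum (fun j => ((hmi j).const_mul _).aemeasurable)]
        congr 1
        · simp
        · refine tsum_congr fun j => ?_
          rw [lintegral_const_mul _ (hmi j), hind, lintegral_indicator_one (hms _)]
    _ ≤ 2 + ∑' j : ℕ, ENNReal.ofReal (2 * 2 ^ (j + 1) * (1 / 3) ^ (j + 1)) := by
        gcongr with j
        rw [ENNReal.ofReal_mul (p := 2 * 2 ^ (j + 1)) (by positivity)]
        gcongr
        rw [← ofReal_measureReal]
        exact ENNReal.ofReal_le_ofReal (h.measureReal_tail_le hv j)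
    _ = ENNReal.ofReal 6 := by
        rw [← ENNReal.ofReal_tsum_of_nonneg (fun j => by positivity) hsum.summable, hsum.tsum_eq,
          show (2 : ℝ≥0∞) = ENNReal.ofReal 2 by simp, ← ENNReal.ofReal_add (by norm_num) (by norm_num)]
        norm_num

theorem integral_exp_inner_le (h : IsotropicLogConcaveOn μ p D)
    {v : EuclideanSpace ℝ (Fin n)} (hv : ‖v‖ ≤ 1 / 1600) : ∫ x, exp ⟪v, x⟫_ℝ ∂μ ≤ 1 + 1 / 40 := by
  have := h.prob
  have hv' : ‖(1600 : ℝ) • v‖ ≤ 1 := by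
    rw [norm_smul]; norm_num; linarith
  have h1 := h.integral_exp_inner_div_eight_le hv'
  have h2 : ∫ x, exp ⟪v, x⟫_ℝ ∂μ ≤
      ∫ x, (199 / 200 + 1 / 200 * exp (⟪(1600 : ℝ) • v, x⟫_ℝ / 8)) ∂μ := by
    refine integral_mono (h.integrable (by fun_prop)) (h.integrable (by fun_prop)) fun x => ?_
    have := convexOn_exp.2 (Set.mem_univ 0) (Set.mem_univ (⟪(1600 : ℝ) • v, x⟫_ℝ / 8))
      (show (0 : ℝ) ≤ 199 / 200 by norm_num) (show (0 : ℝ) ≤ 1 / 200 by norm_num) (by norm_num)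
    simp only [smul_eq_mul, mul_zero, zero_add, exp_zero, mul_one] at this
    refine le_trans (le_of_eq ?_) this
    rw [real_inner_smul_left]
    ring_nf
  rw [integral_add (h.integrable (by fun_prop)) (h.integrable (by fun_prop)),
    integral_const_mul] at h2
  simp at h2
  linarith

theorem one_le_integral_exp_inner (h : IsotropicLogConcaveOn μ p D)
    (v : EuclideanSpace ℝ (Fin n)) : 1 ≤ ∫ x, exp ⟪v, x⟫_ℝ ∂μ := by
  have := h.prob
  have h2 : ∫ x, (⟪v, x⟫_ℝ + 1) ∂μ ≤ ∫ x, exp ⟪v, x⟫_ℝ ∂μ :=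
    integral_mono (h.integrable (by fun_prop)) (h.integrable (by fun_prop)) fun x =>
      add_one_le_exp _
  rw [integral_add (h.integrable (by fun_prop)) (h.integrable (by fun_prop)),
    h.integral_inner] at h2
  simpa using h2

end IsotropicLogConcaveOn

/-- The standard Gaussian measure on `ℝⁿ`. -/
noncomputable abbrev stdGauss (n : ℕ) : Measure (EuclideanSpace ℝ (Fin n)) :=
  ProbabilityTheory.stdGaussian (EuclideanSpace ℝ (Fin n))

section Gaussian

variable {n : ℕ}

theorem map_inner_stdGaussian (a : EuclideanSpace ℝ (Fin n)) :
    Measure.map (fun ω => ⟪a, ω⟫_ℝ) (stdGauss n) =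
      ProbabilityTheory.gaussianReal 0 (‖a‖ ^ 2).toNNReal := by
  have h := ProbabilityTheory.IsGaussian.map_eq_gaussianReal (μ := (stdGauss n)) (innerSL ℝ a)
  rw [ProbabilityTheory.integral_strongDual_stdGaussian,
    ProbabilityTheory.variance_dual_stdGaussian, innerSL_apply_norm] at h
  exact h

theorem integral_exp_inner_stdGaussian (a : EuclideanSpace ℝ (Fin n)) :
    ∫ ω, exp ⟪a, ω⟫_ℝ ∂stdGauss n = exp (‖a‖ ^ 2 / 2) := by
  have h := ProbabilityTheory.mgf_gaussianReal (map_inner_stdGaussian a) 1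
  simp only [ProbabilityTheory.mgf, one_mul] at h
  rw [h, Real.coe_toNNReal _ (sq_nonneg _)]
  ring_nf

theorem integrable_exp_inner_stdGaussian (a : EuclideanSpace ℝ (Fin n)) :
    Integrable (fun ω => exp ⟪a, ω⟫_ℝ) (stdGauss n) := by
  by_contra h
  have := integral_undef h
  rw [integral_exp_inner_stdGaussian] at this
  exact (exp_pos _).ne' this

theorem exp_sqrt_mul_inner_sub_eq (t : ℝ) (y ω : EuclideanSpace ℝ (Fin n)) (c : ℝ) :
    exp (√t * ⟪ω, y⟫_ℝ - c) = exp (-c) * exp ⟪√t • y, ω⟫_ℝ := by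
  rw [← exp_add, real_inner_smul_left, real_inner_comm y ω]
  ring_nf

theorem integrable_exp_sqrt_mul_inner_sub (t : ℝ) (y : EuclideanSpace ℝ (Fin n)) (c : ℝ) :
    Integrable (fun ω => exp (√t * ⟪ω, y⟫_ℝ - c)) (stdGauss n) := by
  simp_rw [exp_sqrt_mul_inner_sub_eq]
  exact (integrable_exp_inner_stdGaussian _).const_mul _

theorem integral_exp_sqrt_mul_inner_sub {t : ℝ} (ht : 0 ≤ t) (y : EuclideanSpace ℝ (Fin n)) (c : ℝ) :
    ∫ ω, exp (√t * ⟪ω, y⟫_ℝ - c) ∂stdGauss n = exp (t * ‖y‖ ^ 2 / 2 - c) := by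
  simp_rw [exp_sqrt_mul_inner_sub_eq]
  rw [integral_const_mul, integral_exp_inner_stdGaussian, norm_smul, mul_pow, Real.norm_eq_abs,
    sq_abs, sq_sqrt ht, ← exp_add]
  ring_nf

theorem integrable_mul_exp_sqrt_mul_inner_sub {X : Type*} [TopologicalSpace X]
    [SecondCountableTopology X] [MeasurableSpace X] [BorelSpace X] {m : Measure X} [SFinite m]
    {t : ℝ} (ht : 0 ≤ t) {y : X → EuclideanSpace ℝ (Fin n)} (hy : Continuous y) {c : X → ℝ}
    (hc : Continuous c) {φ : X → ℝ} (hφ : AEStronglyMeasurable φ m)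
    (hφc : Integrable (fun x => φ x * exp (t * ‖y x‖ ^ 2 / 2 - c x)) m) :
    Integrable (fun z : X × EuclideanSpace ℝ (Fin n) =>
      φ z.1 * exp (√t * ⟪z.2, y z.1⟫_ℝ - c z.1)) (m.prod (stdGauss n)) := by
  have hcont : Continuous fun z : X × EuclideanSpace ℝ (Fin n) =>
    exp (√t * ⟪z.2, y z.1⟫_ℝ - c z.1) := by fun_prop
  have hm : AEStronglyMeasurable (fun z : X × EuclideanSpace ℝ (Fin n) =>
      φ z.1 * exp (√t * ⟪z.2, y z.1⟫_ℝ - c z.1)) (m.prod (stdGauss n)) :=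
    hφ.comp_fst.mul hcont.aestronglyMeasurable
  rw [integrable_prod_iff hm]
  refine ⟨ae_of_all _ fun x => (integrable_exp_sqrt_mul_inner_sub t (y x) (c x)).const_mul (φ x), ?_⟩
  refine hφc.norm.congr (ae_of_all _ fun x => ?_)
  simp only [norm_mul, Real.norm_of_nonneg (exp_pos _).le]
  rw [integral_const_mul, integral_exp_sqrt_mul_inner_sub ht]

theorem integrable_integral_mul_exp_sqrt_mul_inner_sub {X : Type*} [TopologicalSpace X]
    [SecondCountableTopology X] [MeasurableSpace X] [BorelSpace X] {m : Measure X} [SFinite m]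
    {t : ℝ} (ht : 0 ≤ t) {y : X → EuclideanSpace ℝ (Fin n)} (hy : Continuous y) {c : X → ℝ}
    (hc : Continuous c) {φ : X → ℝ} (hφ : AEStronglyMeasurable φ m)
    (hφc : Integrable (fun x => φ x * exp (t * ‖y x‖ ^ 2 / 2 - c x)) m) :
    Integrable (fun ω => ∫ x, φ x * exp (√t * ⟪ω, y x⟫_ℝ - c x) ∂m) (stdGauss n) :=
  (integrable_mul_exp_sqrt_mul_inner_sub ht hy hc hφ hφc).integral_prod_right

theorem integral_integral_mul_exp_sqrt_mul_inner_sub {X : Type*} [TopologicalSpace X]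
    [SecondCountableTopology X] [MeasurableSpace X] [BorelSpace X] {m : Measure X} [SFinite m]
    {t : ℝ} (ht : 0 ≤ t) {y : X → EuclideanSpace ℝ (Fin n)} (hy : Continuous y) {c : X → ℝ}
    (hc : Continuous c) {φ : X → ℝ} (hφ : AEStronglyMeasurable φ m)
    (hφc : Integrable (fun x => φ x * exp (t * ‖y x‖ ^ 2 / 2 - c x)) m) :
    ∫ ω, ∫ x, φ x * exp (√t * ⟪ω, y x⟫_ℝ - c x) ∂m ∂stdGauss n =
      ∫ x, φ x * exp (t * ‖y x‖ ^ 2 / 2 - c x) ∂m := by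
  rw [integral_integral_swap]
  · simp_rw [integral_const_mul, integral_exp_sqrt_mul_inner_sub ht]
  · exact (integrable_mul_exp_sqrt_mul_inner_sub ht hy hc hφ hφc).swap

theorem setIntegral_integral_mul_exp_sqrt_mul_inner_sub {X : Type*} [TopologicalSpace X]
    [SecondCountableTopology X] [MeasurableSpace X] [BorelSpace X] {m : Measure X} [SFinite m]
    {t : ℝ} (ht : 0 ≤ t) {y : X → EuclideanSpace ℝ (Fin n)} (hy : Continuous y) {c : X → ℝ}
    (hc : Continuous c) {φ : X → ℝ} (hφ : AEStronglyMeasurable φ m)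
    (hφc : Integrable (fun x => φ x * exp (t * ‖y x‖ ^ 2 / 2 - c x)) m)
    (S : Set (EuclideanSpace ℝ (Fin n))) :
    ∫ ω in S, ∫ x, φ x * exp (√t * ⟪ω, y x⟫_ℝ - c x) ∂m ∂stdGauss n =
      ∫ x, φ x * ∫ ω in S, exp (√t * ⟪ω, y x⟫_ℝ - c x) ∂stdGauss n ∂m := by
  rw [integral_integral_swap]
  · simp_rw [integral_const_mul]
  · refine (integrable_mul_exp_sqrt_mul_inner_sub ht hy hc hφ hφc).swap.mono_measure ?_
    exact Measure.prod_mono Measure.restrict_le_self le_rfl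

end Gaussian

/-- The weight `x ↦ exp (√t ⟪ω, x⟫ - t ‖x‖² / 2)`. -/
noncomputable def tilt {n : ℕ} (t : ℝ) (ω x : EuclideanSpace ℝ (Fin n)) : ℝ :=
  exp (√t * ⟪ω, x⟫_ℝ - t * ‖x‖ ^ 2 / 2)

theorem tilt_pos {n : ℕ} (t : ℝ) (ω x : EuclideanSpace ℝ (Fin n)) : 0 < tilt t ω x := exp_pos _

@[fun_prop]
theorem continuous_tilt {n : ℕ} (t : ℝ) (ω : EuclideanSpace ℝ (Fin n)) :
    Continuous (tilt t ω) := by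
  unfold tilt
  fun_prop

theorem tilt_rpow_mul_le {n : ℕ} (t : ℝ) (ω x y : EuclideanSpace ℝ (Fin n)) (l : ℝ) :
    tilt t ω x ^ l * tilt t ω y ^ (1 - l) * exp (t * (l * (1 - l) * ‖x - y‖ ^ 2) / 2) =
      tilt t ω (l • x + (1 - l) • y) := by
  unfold tilt
  rw [← exp_mul, ← exp_mul, ← exp_add, ← exp_add]
  congr 1
  rw [norm_sub_sq_real, norm_add_sq_real, norm_smul, norm_smul, inner_add_right, inner_smul_right,
    inner_smul_right, real_inner_smul_left, inner_smul_right, mul_pow, mul_pow, Real.norm_eq_abs,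
    Real.norm_eq_abs, sq_abs, sq_abs]
  ring

namespace IsotropicLogConcaveOn

variable {n : ℕ} {μ : Measure (EuclideanSpace ℝ (Fin n))}
  {p : EuclideanSpace ℝ (Fin n) → ℝ} {D : ℝ}

theorem entropy_tilt_le (h : IsotropicLogConcaveOn μ p D) {t : ℝ} (ht : 0 < t)
    (ω : EuclideanSpace ℝ (Fin n)) {f : EuclideanSpace ℝ (Fin n) → ℝ}
    (hf : ContDiff ℝ (⊤ : ℕ∞) f) :
    entropyFunctional (μ.withDensity fun x => ENNReal.ofReal (tilt t ω x)) (fun x => f x ^ 2) ≤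
      2 / t * ∫ x, ‖gradient f x‖ ^ 2 ∂(μ.withDensity fun x => ENNReal.ofReal (tilt t ω x)) := by
  have hpm := h.measurable
  have hkm : Measurable (tilt t ω) := (continuous_tilt t ω).measurable
  have : NeZero μ := ⟨fun h0 => by have := h.prob.measure_univ; simp [h0] at this⟩
  have hfin : IsFiniteMeasure (μ.withDensity fun x => ENNReal.ofReal (tilt t ω x)) :=
    isFiniteMeasure_withDensity_ofReal (h.integrable (continuous_tilt t ω)).2
  have hae : ∀ᵐ x ∂(μ.withDensity fun x => ENNReal.ofReal (tilt t ω x)), ‖x‖ ≤ D :=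
    (withDensity_absolutelyContinuous μ _).ae_le h.ae_norm_le
  have hpos : 0 < (μ.withDensity fun x => ENNReal.ofReal (tilt t ω x)) Set.univ := by
    rw [pos_iff_ne_zero, ne_eq, Measure.measure_univ_eq_zero, withDensity_eq_zero_iff (by fun_prop)]
    intro h0
    obtain ⟨x, hx⟩ := (h0.mono fun x hx => hx).exists
    simp only [Pi.zero_apply, ENNReal.ofReal_eq_zero] at hx
    exact absurd hx (not_le.2 (tilt_pos _ _ _))
  refine entropy_sq_le_of_forall_exp ht hae (fun g hg => ?_) hf
  refine entropy_exp_le_of_strongly_logconcave (q := fun x => p x * tilt t ω x) (R := D)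
    (by fun_prop) (fun x => mul_nonneg (h.nonneg x) (tilt_pos _ _ _).le) ht ?_ ?_ ?_ hpos hg
  · intro x y l h0 h1
    have hx := tilt_pos t ω x
    have hy := tilt_pos t ω y
    rw [mul_rpow (h.nonneg x) hx.le, mul_rpow (h.nonneg y) hy.le, ← tilt_rpow_mul_le]
    have := h.logconcave x y l h0 h1
    calc _ = p x ^ l * p y ^ (1 - l) * (tilt t ω x ^ l * tilt t ω y ^ (1 - l) *
          exp (t * (l * (1 - l) * ‖x - y‖ ^ 2) / 2)) := by ring
      _ ≤ _ := by gcongr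
  · intro x hx
    exact h.norm_le x (pos_of_mul_pos_left hx (tilt_pos _ _ _).le)
  · rw [h.eq_withDensity, ← withDensity_mul _ (by fun_prop) (by fun_prop)]
    congr 1
    ext x
    simp [ENNReal.ofReal_mul (h.nonneg x)]

theorem integral_withDensity_tilt (t : ℝ) (ω : EuclideanSpace ℝ (Fin n))
    (φ : EuclideanSpace ℝ (Fin n) → ℝ) :
    ∫ x, φ x ∂(μ.withDensity fun x => ENNReal.ofReal (tilt t ω x)) = ∫ x, φ x * tilt t ω x ∂μ := by
  have hkm : Measurable (tilt t ω) := (continuous_tilt t ω).measurable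
  rw [integral_withDensity_eq_integral_toReal_smul (by fun_prop) (ae_of_all _ fun x => by simp)]
  refine integral_congr_ae (ae_of_all _ fun x => ?_)
  simp [ENNReal.toReal_ofReal (tilt_pos t ω x).le, mul_comm]

theorem measureReal_withDensity_tilt (t : ℝ) (ω : EuclideanSpace ℝ (Fin n)) :
    (μ.withDensity fun x => ENNReal.ofReal (tilt t ω x)).real Set.univ = ∫ x, tilt t ω x ∂μ := by
  have := integral_withDensity_tilt (μ := μ) t ω (fun _ => 1)
  simpa using this

theorem poincare_tilt (h : IsotropicLogConcaveOn μ p D) {t : ℝ} (ht : 0 < t)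
    {ω : EuclideanSpace ℝ (Fin n)} (hω : 1 / 2 ≤ ∫ x, tilt t ω x ∂μ)
    {f : EuclideanSpace ℝ (Fin n) → ℝ} (hf : ContDiff ℝ (⊤ : ℕ∞) f) :
    ∫ x, f x ^ 2 * tilt t ω x ∂μ - 2 * (∫ x, f x * tilt t ω x ∂μ) ^ 2 ≤
      2 / t * ∫ x, ‖gradient f x‖ ^ 2 * tilt t ω x ∂μ := by
  have hfin : IsFiniteMeasure (μ.withDensity fun x => ENNReal.ofReal (tilt t ω x)) :=
    isFiniteMeasure_withDensity_ofReal (h.integrable (continuous_tilt t ω)).2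
  have hae : ∀ᵐ x ∂(μ.withDensity fun x => ENNReal.ofReal (tilt t ω x)), ‖x‖ ≤ D :=
    (withDensity_absolutelyContinuous μ _).ae_le h.ae_norm_le
  have hpos : 0 < (μ.withDensity fun x => ENNReal.ofReal (tilt t ω x)) Set.univ := by
    have := measureReal_withDensity_tilt (μ := μ) t ω
    rw [pos_iff_ne_zero]
    intro h0
    rw [measureReal_def, h0, ENNReal.toReal_zero] at this
    linarith
  have h1 := poincare_of_forall_entropy_sq_le hpos hae (fun f hf => h.entropy_tilt_le ht ω hf) hf
  simp only [integral_withDensity_tilt, measureReal_withDensity_tilt] at h1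
  refine le_trans ?_ h1
  have h2 : (∫ x, f x * tilt t ω x ∂μ) ^ 2 / ∫ x, tilt t ω x ∂μ ≤
      2 * (∫ x, f x * tilt t ω x ∂μ) ^ 2 := by
    rw [div_le_iff₀ (by linarith)]
    nlinarith [sq_nonneg (∫ x, f x * tilt t ω x ∂μ)]
  linarith

theorem integral_mul_tilt_le (h : IsotropicLogConcaveOn μ p D) {t : ℝ} (ht : 0 < t)
    {ω : EuclideanSpace ℝ (Fin n)} (hω : 1 / 2 ≤ ∫ x, tilt t ω x ∂μ)
    {f : EuclideanSpace ℝ (Fin n) → ℝ} (hf : ContDiff ℝ (⊤ : ℕ∞) f)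
    {b : EuclideanSpace ℝ (Fin n) → ℝ} (hb : Continuous b) (hb0 : ∀ x, 0 < b x) :
    ∫ x, f x ^ 2 * (log (f x ^ 2) - log (b x) - (∫ y, f y ^ 2 * tilt t ω y ∂μ) / b x + 1 - log 2)
      * tilt t ω x ∂μ ≤ 2 / t * ∫ x, ‖gradient f x‖ ^ 2 * tilt t ω x ∂μ := by
  have hfin : IsFiniteMeasure (μ.withDensity fun x => ENNReal.ofReal (tilt t ω x)) :=
    isFiniteMeasure_withDensity_ofReal (h.integrable (continuous_tilt t ω)).2
  have hae : ∀ᵐ x ∂(μ.withDensity fun x => ENNReal.ofReal (tilt t ω x)), ‖x‖ ≤ D :=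
    (withDensity_absolutelyContinuous μ _).ae_le h.ae_norm_le
  have h1 := integral_le_entropy_sq hae ((measureReal_withDensity_tilt t ω).symm ▸ hω)
    hf.continuous hb hb0
  have h2 := h1.trans (h.entropy_tilt_le ht ω hf)
  simpa only [integral_withDensity_tilt] using h2

end IsotropicLogConcaveOn

theorem integrable_tilt_right {n : ℕ} (t : ℝ) (x : EuclideanSpace ℝ (Fin n)) :
    Integrable (fun ω => tilt t ω x) (stdGauss n) :=
  integrable_exp_sqrt_mul_inner_sub t x _

theorem integral_tilt_right {n : ℕ} {t : ℝ} (ht : 0 ≤ t) (x : EuclideanSpace ℝ (Fin n)) :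
    ∫ ω, tilt t ω x ∂stdGauss n = 1 := by
  unfold tilt
  rw [integral_exp_sqrt_mul_inner_sub ht]
  simp

theorem tilt_mul_tilt {n : ℕ} (t : ℝ) (ω x y : EuclideanSpace ℝ (Fin n)) :
    tilt t ω x * tilt t ω y =
      exp (√t * ⟪ω, x + y⟫_ℝ - (t * ‖x‖ ^ 2 / 2 + t * ‖y‖ ^ 2 / 2)) := by
  unfold tilt
  rw [← exp_add, inner_add_right]
  ring_nf

namespace IsotropicLogConcaveOn

variable {n : ℕ} {μ : Measure (EuclideanSpace ℝ (Fin n))}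
  {p : EuclideanSpace ℝ (Fin n) → ℝ} {D : ℝ}

theorem integrable_prod (h : IsotropicLogConcaveOn μ p D)
    {φ : EuclideanSpace ℝ (Fin n) × EuclideanSpace ℝ (Fin n) → ℝ} (hφ : Continuous φ) :
    Integrable φ (μ.prod μ) := by
  have := h.prob
  obtain ⟨C, hC⟩ := ((isCompact_closedBall (0 : EuclideanSpace ℝ (Fin n)) D).prod
    (isCompact_closedBall (0 : EuclideanSpace ℝ (Fin n)) D)).exists_bound_of_continuousOn
    hφ.continuousOn
  refine Integrable.of_bound hφ.aestronglyMeasurable C ?_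
  have h1 : ∀ᵐ z ∂μ.prod μ, ‖z.1‖ ≤ D := Measure.quasiMeasurePreserving_fst.ae h.ae_norm_le
  have h2 : ∀ᵐ z ∂μ.prod μ, ‖z.2‖ ≤ D := Measure.quasiMeasurePreserving_snd.ae h.ae_norm_le
  filter_upwards [h1, h2] with z hz1 hz2
  exact hC z ⟨by simpa using hz1, by simpa using hz2⟩

section Fubini

variable {t : ℝ}

theorem integrable_integral_mul_tilt (h : IsotropicLogConcaveOn μ p D) (ht : 0 ≤ t)
    {φ : EuclideanSpace ℝ (Fin n) → ℝ} (hφ : Continuous φ) :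
    Integrable (fun ω => ∫ x, φ x * tilt t ω x ∂μ) (stdGauss n) :=
  have := h.prob
  integrable_integral_mul_exp_sqrt_mul_inner_sub ht (y := fun x => x)
    (c := fun x => t * ‖x‖ ^ 2 / 2) (by fun_prop) (by fun_prop) hφ.aestronglyMeasurable
    (h.integrable (by fun_prop))

theorem setIntegral_integral_mul_tilt (h : IsotropicLogConcaveOn μ p D) (ht : 0 ≤ t)
    {φ : EuclideanSpace ℝ (Fin n) → ℝ} (hφ : Continuous φ) (S : Set (EuclideanSpace ℝ (Fin n))) :
    ∫ ω in S, ∫ x, φ x * tilt t ω x ∂μ ∂stdGauss n =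
      ∫ x, φ x * ∫ ω in S, tilt t ω x ∂stdGauss n ∂μ :=
  have := h.prob
  setIntegral_integral_mul_exp_sqrt_mul_inner_sub ht (y := fun x => x)
    (c := fun x => t * ‖x‖ ^ 2 / 2) (by fun_prop) (by fun_prop) hφ.aestronglyMeasurable
    (h.integrable (by fun_prop)) S

theorem integrable_integral_mul_tilt_mul_tilt (h : IsotropicLogConcaveOn μ p D) (ht : 0 ≤ t)
    {φ : EuclideanSpace ℝ (Fin n) × EuclideanSpace ℝ (Fin n) → ℝ} (hφ : Continuous φ) :
    Integrable (fun ω => ∫ z, φ z * (tilt t ω z.1 * tilt t ω z.2) ∂μ.prod μ) (stdGauss n) := by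
  have := h.prob
  simp_rw [tilt_mul_tilt]
  exact integrable_integral_mul_exp_sqrt_mul_inner_sub ht
    (y := fun z : EuclideanSpace ℝ (Fin n) × EuclideanSpace ℝ (Fin n) => z.1 + z.2)
    (c := fun z => t * ‖z.1‖ ^ 2 / 2 + t * ‖z.2‖ ^ 2 / 2) (by fun_prop) (by fun_prop)
    hφ.aestronglyMeasurable (h.integrable_prod (by fun_prop))

theorem integral_integral_mul_tilt_mul_tilt (h : IsotropicLogConcaveOn μ p D) (ht : 0 ≤ t)
    {φ : EuclideanSpace ℝ (Fin n) × EuclideanSpace ℝ (Fin n) → ℝ} (hφ : Continuous φ) :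
    ∫ ω, ∫ z, φ z * (tilt t ω z.1 * tilt t ω z.2) ∂μ.prod μ ∂stdGauss n =
      ∫ z, φ z * exp (t * ⟪z.1, z.2⟫_ℝ) ∂μ.prod μ := by
  have := h.prob
  simp_rw [tilt_mul_tilt]
  rw [integral_integral_mul_exp_sqrt_mul_inner_sub ht
    (y := fun z : EuclideanSpace ℝ (Fin n) × EuclideanSpace ℝ (Fin n) => z.1 + z.2)
    (c := fun z => t * ‖z.1‖ ^ 2 / 2 + t * ‖z.2‖ ^ 2 / 2) (by fun_prop) (by fun_prop)
    hφ.aestronglyMeasurable (h.integrable_prod (by fun_prop))]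
  congr 1
  ext z
  rw [norm_add_sq_real]
  ring_nf

end Fubini

theorem measurable_integral_tilt (h : IsotropicLogConcaveOn μ p D) (t : ℝ) :
    Measurable fun ω => ∫ x, tilt t ω x ∂μ := by
  have := h.prob
  have hc : Continuous (Function.uncurry fun ω x : EuclideanSpace ℝ (Fin n) => tilt t ω x) := by
    unfold tilt Function.uncurry
    fun_prop
  exact hc.stronglyMeasurable.integral_prod_right.measurable

theorem measurableSet_half_le_integral_tilt (h : IsotropicLogConcaveOn μ p D) (t : ℝ) :
    MeasurableSet {ω | 1 / 2 ≤ ∫ x, tilt t ω x ∂μ} :=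
  measurableSet_le measurable_const (h.measurable_integral_tilt t)

theorem setIntegral_tilt_le_one {t : ℝ} (ht : 0 ≤ t) (S : Set (EuclideanSpace ℝ (Fin n)))
    (x : EuclideanSpace ℝ (Fin n)) : ∫ ω in S, tilt t ω x ∂stdGauss n ≤ 1 :=
  (setIntegral_le_integral (integrable_tilt_right t x) (ae_of_all _ fun ω => (tilt_pos t ω x).le)).trans
    (integral_tilt_right ht x).le

theorem setIntegral_tilt_nonneg (t : ℝ) (S : Set (EuclideanSpace ℝ (Fin n)))
    (x : EuclideanSpace ℝ (Fin n)) : 0 ≤ ∫ ω in S, tilt t ω x ∂stdGauss n :=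
  integral_nonneg fun ω => (tilt_pos t ω x).le

section Small

variable {t : ℝ}

theorem integral_exp_mul_inner_le (h : IsotropicLogConcaveOn μ p D) (ht : 0 ≤ t)
    (htD : t * D ≤ 1 / 3200)
    {x : EuclideanSpace ℝ (Fin n)} (hx : ‖x‖ ≤ 2 * D) :
    ∫ y, exp (t * ⟪x, y⟫_ℝ) ∂μ ≤ 1 + 1 / 40 := by
  have h1 : ‖t • x‖ ≤ 1 / 1600 := by
    rw [norm_smul, Real.norm_of_nonneg ht]
    nlinarith
  simpa only [real_inner_smul_left] using h.integral_exp_inner_le h1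

/-- The part of the Gaussian average of the tilts carried by tilts of large mass. -/
theorem le_setIntegral_tilt (h : IsotropicLogConcaveOn μ p D) (ht : 0 ≤ t)
    (htD : t * D ≤ 1 / 3200)
    {y : EuclideanSpace ℝ (Fin n)} (hy : ‖y‖ ≤ D) :
    3 / 4 ≤ ∫ ω in {ω | 1 / 2 ≤ ∫ x, tilt t ω x ∂μ}, tilt t ω y ∂stdGauss n := by
  have := h.prob
  set S := {ω | 1 / 2 ≤ ∫ x, tilt t ω x ∂μ} with hS
  have hSm : MeasurableSet S := h.measurableSet_half_le_integral_tilt t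
  have c1 : ∀ ω x : EuclideanSpace ℝ (Fin n), tilt t ω y * tilt t ω x =
      1 * exp (√t * ⟪ω, y + x⟫_ℝ - (t * ‖y‖ ^ 2 / 2 + t * ‖x‖ ^ 2 / 2)) := fun ω x => by
    rw [tilt_mul_tilt, one_mul]
  have c2 : ∀ (ω : EuclideanSpace ℝ (Fin n)) (z : EuclideanSpace ℝ (Fin n) × EuclideanSpace ℝ (Fin n)),
      tilt t ω y * (tilt t ω z.1 * tilt t ω z.2) = 1 * exp (√t * ⟪ω, y + z.1 + z.2⟫_ℝ -
        (t * ‖y‖ ^ 2 / 2 + t * ‖z.1‖ ^ 2 / 2 + t * ‖z.2‖ ^ 2 / 2)) := fun ω z => by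
    unfold tilt
    rw [← exp_add, ← exp_add, one_mul, inner_add_right, inner_add_right]
    ring_nf
  have i1 := integrable_integral_mul_exp_sqrt_mul_inner_sub (m := μ) ht (y := fun x => y + x)
    (c := fun x => t * ‖y‖ ^ 2 / 2 + t * ‖x‖ ^ 2 / 2) (φ := fun _ => 1) (by fun_prop) (by fun_prop)
    (by fun_prop) (h.integrable (by fun_prop))
  have v1 := integral_integral_mul_exp_sqrt_mul_inner_sub (m := μ) ht (y := fun x => y + x)
    (c := fun x => t * ‖y‖ ^ 2 / 2 + t * ‖x‖ ^ 2 / 2) (φ := fun _ => 1) (by fun_prop) (by fun_prop)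
    (by fun_prop) (h.integrable (by fun_prop))
  have i2 := integrable_integral_mul_exp_sqrt_mul_inner_sub (m := μ.prod μ) ht
    (y := fun z => y + z.1 + z.2)
    (c := fun z => t * ‖y‖ ^ 2 / 2 + t * ‖z.1‖ ^ 2 / 2 + t * ‖z.2‖ ^ 2 / 2) (φ := fun _ => 1)
    (by fun_prop) (by fun_prop) (by fun_prop) (h.integrable_prod (by fun_prop))
  have v2 := integral_integral_mul_exp_sqrt_mul_inner_sub (m := μ.prod μ) ht
    (y := fun z => y + z.1 + z.2)
    (c := fun z => t * ‖y‖ ^ 2 / 2 + t * ‖z.1‖ ^ 2 / 2 + t * ‖z.2‖ ^ 2 / 2) (φ := fun _ => 1)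
    (by fun_prop) (by fun_prop) (by fun_prop) (h.integrable_prod (by fun_prop))
  simp only [← c1, integral_const_mul] at i1 v1
  simp only [← c2, integral_const_mul] at i2 v2
  have hpm : ∀ ω, ∫ a, tilt t ω a.1 * tilt t ω a.2 ∂μ.prod μ =
      (∫ x, tilt t ω x ∂μ) * ∫ x, tilt t ω x ∂μ :=
    fun ω => integral_prod_mul (tilt t ω) (tilt t ω)
  simp only [hpm, one_mul] at i2 v1 v2
  have b1 : 1 ≤ ∫ ω, tilt t ω y * ∫ x, tilt t ω x ∂μ ∂stdGauss n := by
    rw [v1]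
    refine (h.one_le_integral_exp_inner (t • y)).trans (le_of_eq ?_)
    congr 1
    ext x
    rw [norm_add_sq_real, real_inner_smul_left]
    ring_nf
  have b2 : ∫ ω, tilt t ω y * ((∫ x, tilt t ω x ∂μ) * ∫ x, tilt t ω x ∂μ) ∂stdGauss n ≤
      (1 + 1 / 40) ^ 2 := by
    rw [v2, integral_prod _ (h.integrable_prod (by fun_prop))]
    have e : ∀ x x' : EuclideanSpace ℝ (Fin n), exp (t * ‖y + x + x'‖ ^ 2 / 2 -
        (t * ‖y‖ ^ 2 / 2 + t * ‖x‖ ^ 2 / 2 + t * ‖x'‖ ^ 2 / 2)) =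
        exp (t * ⟪y, x⟫_ℝ) * exp (t * ⟪y + x, x'⟫_ℝ) := fun x x' => by
      rw [← exp_add, norm_add_sq_real, norm_add_sq_real]
      ring_nf
    simp only [e, integral_const_mul]
    calc ∫ x, exp (t * ⟪y, x⟫_ℝ) * ∫ x', exp (t * ⟪y + x, x'⟫_ℝ) ∂μ ∂μ
        ≤ ∫ x, exp (t * ⟪y, x⟫_ℝ) * (1 + 1 / 40) ∂μ := by
          refine integral_mono_of_nonneg (ae_of_all _ fun x => ?_) (h.integrable (by fun_prop)) ?_
          · exact mul_nonneg (exp_pos _).le (integral_nonneg fun _ => (exp_pos _).le)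
          · filter_upwards [h.ae_norm_le] with x hx
            refine mul_le_mul_of_nonneg_left (h.integral_exp_mul_inner_le ht htD ?_) (exp_pos _).le
            linarith [norm_add_le y x]
      _ ≤ _ := by
        rw [integral_mul_const, sq]
        refine mul_le_mul_of_nonneg_right (h.integral_exp_mul_inner_le ht htD ?_) (by norm_num)
        linarith [norm_nonneg y]
  have i0 := integrable_tilt_right t y
  have hbad : ∫ ω in Sᶜ, tilt t ω y ∂stdGauss n ≤ ∫ ω, 4 * (tilt t ω y *
      ((∫ x, tilt t ω x ∂μ) * ∫ x, tilt t ω x ∂μ) - 2 * (tilt t ω y * ∫ x, tilt t ω x ∂μ)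
      + tilt t ω y) ∂stdGauss n := by
    have hi : Integrable (fun ω => 4 * (tilt t ω y *
        ((∫ x, tilt t ω x ∂μ) * ∫ x, tilt t ω x ∂μ) - 2 * (tilt t ω y * ∫ x, tilt t ω x ∂μ)
        + tilt t ω y)) (stdGauss n) := ((i2.sub (i1.const_mul 2)).add i0).const_mul 4
    refine le_trans (setIntegral_mono_on i0.integrableOn hi.integrableOn hSm.compl fun ω hω => ?_)
      (setIntegral_le_integral hi (ae_of_all _ fun ω => ?_))
    · have hω' : ∫ x, tilt t ω x ∂μ < 1 / 2 := by
        simpa only [hS, Set.mem_compl_iff, Set.mem_ofPred_eq, not_le] using hω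
      have := tilt_pos t ω y
      set Z := ∫ x, tilt t ω x ∂μ
      have h3 : 1 / 4 ≤ (Z - 1) ^ 2 := by nlinarith
      nlinarith [mul_le_mul_of_nonneg_left h3 this.le]
    · have := tilt_pos t ω y
      simp only [Pi.zero_apply]
      set Z := ∫ x, tilt t ω x ∂μ
      nlinarith [mul_nonneg this.le (sq_nonneg (Z - 1))]
  have i3 : Integrable (fun ω => tilt t ω y * ((∫ x, tilt t ω x ∂μ) * ∫ x, tilt t ω x ∂μ) -
      2 * (tilt t ω y * ∫ x, tilt t ω x ∂μ)) (stdGauss n) := i2.sub (i1.const_mul 2)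
  rw [integral_const_mul, integral_add i3 i0,
    integral_sub i2 (i1.const_mul 2), integral_const_mul, integral_tilt_right ht] at hbad
  have := integral_add_compl hSm i0
  rw [integral_tilt_right ht] at this
  linarith

end Small

end IsotropicLogConcaveOn

namespace IsotropicLogConcaveOn

variable {n : ℕ} {μ : Measure (EuclideanSpace ℝ (Fin n))}
  {p : EuclideanSpace ℝ (Fin n) → ℝ} {D t : ℝ}

theorem integral_exp_two_mul_inner_le (h : IsotropicLogConcaveOn μ p D) (ht : 0 ≤ t)
    (htD : t * D ≤ 1 / 3200) {x : EuclideanSpace ℝ (Fin n)} (hx : ‖x‖ ≤ D) :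
    ∫ y, exp (t * ⟪x, y⟫_ℝ) ^ 2 ∂μ ≤ 1 + 1 / 40 := by
  have h1 : ‖(2 : ℝ) • x‖ ≤ 2 * D := by
    rw [norm_smul, Real.norm_ofNat]
    linarith
  refine le_of_eq_of_le ?_ (h.integral_exp_mul_inner_le ht htD h1)
  congr 1
  ext y
  rw [← exp_nat_mul, real_inner_smul_left]
  push_cast
  ring_nf

theorem integral_exp_inner_sub_one_sq_le (h : IsotropicLogConcaveOn μ p D) (ht : 0 ≤ t)
    (htD : t * D ≤ 1 / 3200) :
    ∫ z, (exp (t * ⟪z.1, z.2⟫_ℝ) - 1) ^ 2 ∂μ.prod μ ≤ 1 / 40 := by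
  have := h.prob
  rw [integral_prod _ (h.integrable_prod (by fun_prop))]
  have h1 : ∀ᵐ x ∂μ, ∫ y, (exp (t * ⟪x, y⟫_ℝ) - 1) ^ 2 ∂μ ≤ 1 / 40 := by
    filter_upwards [h.ae_norm_le] with x hx
    have h2 := h.integral_exp_two_mul_inner_le ht htD hx
    have h3 := h.one_le_integral_exp_inner (t • x)
    simp only [real_inner_smul_left] at h3
    have e : ∫ y, (exp (t * ⟪x, y⟫_ℝ) - 1) ^ 2 ∂μ =
        ∫ y, exp (t * ⟪x, y⟫_ℝ) ^ 2 ∂μ - 2 * ∫ y, exp (t * ⟪x, y⟫_ℝ) ∂μ + 1 := by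
      rw [← integral_const_mul, ← integral_sub (h.integrable (by fun_prop))
        (h.integrable (by fun_prop))]
      have : (1 : ℝ) = ∫ _, 1 ∂μ := by simp
      conv_rhs => rw [this]
      rw [← integral_add (h.integrable (by fun_prop)) (h.integrable (by fun_prop))]
      congr 1
      ext y
      ring
    linarith
  have h4 := integral_mono_of_nonneg (μ := μ)
    (ae_of_all _ fun x => integral_nonneg fun y => sq_nonneg (exp (t * ⟪x, y⟫_ℝ) - 1))
    (integrable_const _) h1
  simpa using h4

theorem integral_mul_exp_inner_le (h : IsotropicLogConcaveOn μ p D) (ht : 0 ≤ t)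
    (htD : t * D ≤ 1 / 3200) {g : EuclideanSpace ℝ (Fin n) → ℝ} (hg : Continuous g)
    (hg0 : ∫ x, g x ∂μ = 0) :
    ∫ z, g z.1 * g z.2 * exp (t * ⟪z.1, z.2⟫_ℝ) ∂μ.prod μ ≤ (∫ x, g x ^ 2 ∂μ) / 4 := by
  have := h.prob
  set V := ∫ x, g x ^ 2 ∂μ with hV
  have hV0 : 0 ≤ V := integral_nonneg fun x => sq_nonneg _
  have e1 : ∫ z, g z.1 * g z.2 * exp (t * ⟪z.1, z.2⟫_ℝ) ∂μ.prod μ =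
      ∫ z, g z.1 * g z.2 * (exp (t * ⟪z.1, z.2⟫_ℝ) - 1) ∂μ.prod μ := by
    simp only [mul_sub, mul_one]
    rw [integral_sub (h.integrable_prod (by fun_prop)) (h.integrable_prod (by fun_prop)),
      integral_prod_mul g g, hg0]
    simp
  have e2 : ∫ z, (g z.1 * g z.2) ^ 2 ∂μ.prod μ = V * V := by
    simp only [mul_pow]
    exact integral_prod_mul (fun x => g x ^ 2) (fun x => g x ^ 2)
  have key : ∀ a : ℝ, 0 < a → ∫ z, g z.1 * g z.2 * (exp (t * ⟪z.1, z.2⟫_ℝ) - 1) ∂μ.prod μ ≤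
      a / 2 * (V * V) + 1 / (2 * a) * (1 / 40) := by
    intro a ha
    calc _ ≤ ∫ z, (a / 2 * (g z.1 * g z.2) ^ 2 +
        1 / (2 * a) * (exp (t * ⟪z.1, z.2⟫_ℝ) - 1) ^ 2) ∂μ.prod μ := by
          refine integral_mono (h.integrable_prod (by fun_prop)) (h.integrable_prod (by fun_prop))
            fun z => ?_
          dsimp only
          set A := g z.1 * g z.2
          set B := exp (t * ⟪z.1, z.2⟫_ℝ) - 1
          have : a / 2 * A ^ 2 + 1 / (2 * a) * B ^ 2 - A * B = (a * A - B) ^ 2 / (2 * a) := by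
            field_simp
            ring
          have := div_nonneg (sq_nonneg (a * A - B)) (by positivity : 0 ≤ 2 * a)
          linarith
      _ ≤ _ := by
          rw [integral_add (h.integrable_prod (by fun_prop)) (h.integrable_prod (by fun_prop)),
            integral_const_mul, integral_const_mul, e2]
          gcongr
          exact h.integral_exp_inner_sub_one_sq_le ht htD
  rw [e1]
  rcases hV0.eq_or_lt with h0 | h0
  · have hz : (fun x => g x ^ 2) =ᵐ[μ] 0 := (integral_eq_zero_iff_of_nonneg
      (fun x => sq_nonneg _) (h.integrable (hg.pow 2))).1 h0.symm
    rw [← h0, zero_div]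
    refine le_of_eq (integral_eq_zero_of_ae ?_)
    filter_upwards [Measure.quasiMeasurePreserving_fst.ae hz] with z hz
    have : g z.1 = 0 := by simpa using hz
    simp [this]
  · refine (key (1 / (4 * V)) (by positivity)).trans ?_
    have : 1 / (4 * V) / 2 * (V * V) + 1 / (2 * (1 / (4 * V))) * (1 / 40) = V / 8 + V / 20 := by
      field_simp
      ring
    linarith

theorem integral_integral_mul_tilt_sq (h : IsotropicLogConcaveOn μ p D) (ht : 0 ≤ t)
    {g : EuclideanSpace ℝ (Fin n) → ℝ} (hg : Continuous g) :
    Integrable (fun ω => (∫ x, g x * tilt t ω x ∂μ) ^ 2) (stdGauss n) ∧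
    ∫ ω, (∫ x, g x * tilt t ω x ∂μ) ^ 2 ∂stdGauss n =
      ∫ z, g z.1 * g z.2 * exp (t * ⟪z.1, z.2⟫_ℝ) ∂μ.prod μ := by
  have := h.prob
  have e : ∀ ω, (∫ x, g x * tilt t ω x ∂μ) ^ 2 =
      ∫ z, g z.1 * g z.2 * (tilt t ω z.1 * tilt t ω z.2) ∂μ.prod μ := fun ω => by
    rw [sq, ← integral_prod_mul]
    congr 1
    ext z
    ring
  simp only [e]
  exact ⟨h.integrable_integral_mul_tilt_mul_tilt ht (φ := fun z => g z.1 * g z.2) (by fun_prop),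
    h.integral_integral_mul_tilt_mul_tilt ht (φ := fun z => g z.1 * g z.2) (by fun_prop)⟩

theorem measurable_setIntegral_tilt (t : ℝ) (S : Set (EuclideanSpace ℝ (Fin n))) :
    Measurable fun x => ∫ ω in S, tilt t ω x ∂stdGauss n := by
  have hc : Continuous (Function.uncurry fun x ω : EuclideanSpace ℝ (Fin n) => tilt t ω x) := by
    unfold tilt Function.uncurry
    fun_prop
  exact hc.stronglyMeasurable.integral_prod_right.measurable

theorem integrable_mul_setIntegral_tilt (h : IsotropicLogConcaveOn μ p D) (ht : 0 ≤ t)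
    {φ : EuclideanSpace ℝ (Fin n) → ℝ} (hφ : Continuous φ) (S : Set (EuclideanSpace ℝ (Fin n))) :
    Integrable (fun x => φ x * ∫ ω in S, tilt t ω x ∂stdGauss n) μ := by
  refine (h.integrable hφ).mul_bdd (c := 1) (measurable_setIntegral_tilt t S).aestronglyMeasurable
    (ae_of_all _ fun x => ?_)
  rw [Real.norm_of_nonneg (setIntegral_tilt_nonneg t S x)]
  exact setIntegral_tilt_le_one ht S x

theorem integral_mul_setIntegral_tilt_le (h : IsotropicLogConcaveOn μ p D) (ht : 0 ≤ t)
    {φ : EuclideanSpace ℝ (Fin n) → ℝ} (hφ : Continuous φ) (hφ0 : ∀ x, 0 ≤ φ x)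
    (S : Set (EuclideanSpace ℝ (Fin n))) :
    ∫ x, φ x * ∫ ω in S, tilt t ω x ∂stdGauss n ∂μ ≤ ∫ x, φ x ∂μ :=
  integral_mono (h.integrable_mul_setIntegral_tilt ht hφ S) (h.integrable hφ) fun x =>
    mul_le_of_le_one_right (hφ0 x) (setIntegral_tilt_le_one ht S x)

theorem le_integral_mul_setIntegral_tilt (h : IsotropicLogConcaveOn μ p D) (ht : 0 ≤ t)
    (htD : t * D ≤ 1 / 3200) {φ : EuclideanSpace ℝ (Fin n) → ℝ} (hφ : Continuous φ)
    (hφ0 : ∀ x, 0 ≤ φ x) :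
    3 / 4 * ∫ x, φ x ∂μ ≤ ∫ x, φ x *
      ∫ ω in {ω | 1 / 2 ≤ ∫ x, tilt t ω x ∂μ}, tilt t ω x ∂stdGauss n ∂μ := by
  rw [← integral_const_mul]
  refine integral_mono_ae (h.integrable (by fun_prop)) (h.integrable_mul_setIntegral_tilt ht hφ _) ?_
  filter_upwards [h.ae_norm_le] with x hx
  rw [mul_comm]
  exact mul_le_mul_of_nonneg_left (h.le_setIntegral_tilt ht htD hx) (hφ0 x)

theorem poincare (h : IsotropicLogConcaveOn μ p D) (ht : 0 < t)
    (htD : t * D ≤ 1 / 3200) {f : EuclideanSpace ℝ (Fin n) → ℝ} (hf : ContDiff ℝ (⊤ : ℕ∞) f)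
    (hf0 : ∫ x, f x ∂μ = 0) :
    ∫ x, f x ^ 2 ∂μ ≤ 8 / t * ∫ x, ‖gradient f x‖ ^ 2 ∂μ := by
  have hfc := hf.continuous
  have hfg := hf.continuous_gradient'
  set S := {ω | 1 / 2 ≤ ∫ x, tilt t ω x ∂μ} with hS
  have hSm : MeasurableSet S := h.measurableSet_half_le_integral_tilt t
  obtain ⟨i2, v2⟩ := h.integral_integral_mul_tilt_sq ht.le hfc
  have i1 := h.integrable_integral_mul_tilt ht.le (φ := fun x => f x ^ 2) (by fun_prop)
  have i3 := h.integrable_integral_mul_tilt ht.le (φ := fun x => ‖gradient f x‖ ^ 2) (by fun_prop)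
  have H : ∫ ω in S, (∫ x, f x ^ 2 * tilt t ω x ∂μ - 2 * (∫ x, f x * tilt t ω x ∂μ) ^ 2) ∂stdGauss n ≤
      ∫ ω in S, 2 / t * ∫ x, ‖gradient f x‖ ^ 2 * tilt t ω x ∂μ ∂stdGauss n :=
    setIntegral_mono_on (i1.sub (i2.const_mul 2)).integrableOn (i3.const_mul _).integrableOn hSm
      fun ω hω => h.poincare_tilt ht hω hf
  rw [integral_sub i1.integrableOn (i2.const_mul 2).integrableOn, integral_const_mul,
    integral_const_mul, h.setIntegral_integral_mul_tilt ht.le (φ := fun x => f x ^ 2) (by fun_prop),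
    h.setIntegral_integral_mul_tilt ht.le (φ := fun x => ‖gradient f x‖ ^ 2) (by fun_prop)] at H
  have b1 := h.le_integral_mul_setIntegral_tilt ht.le htD (φ := fun x => f x ^ 2) (by fun_prop)
    fun x => sq_nonneg _
  have b2 := setIntegral_le_integral (s := S) i2 (ae_of_all _ fun ω => sq_nonneg _)
  have b3 := h.integral_mul_setIntegral_tilt_le ht.le (φ := fun x => ‖gradient f x‖ ^ 2)
    (by fun_prop) (fun x => sq_nonneg _) S
  have b4 := h.integral_mul_exp_inner_le ht.le htD hfc hf0
  have b5 := mul_le_mul_of_nonneg_left b3 (by positivity : 0 ≤ 2 / t)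
  have e : 8 / t * ∫ x, ‖gradient f x‖ ^ 2 ∂μ = 4 * (2 / t * ∫ x, ‖gradient f x‖ ^ 2 ∂μ) := by ring
  rw [v2] at b2
  linarith

end IsotropicLogConcaveOn

theorem sub_one_le_mul_log {x : ℝ} (hx : 0 ≤ x) : x - 1 ≤ x * log x := by
  rcases hx.eq_or_lt with rfl | hx
  · simp
  · have := mul_le_mul_of_nonneg_left (one_sub_inv_le_log_of_pos hx) hx.le
    rwa [mul_sub, mul_inv_cancel₀ hx.ne', mul_one] at this

theorem two_mul_mul_log_le {x b : ℝ} (hx : 0 ≤ x) (hb : 0 < b) :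
    2 * (x * log b) ≤ x * log x + b ^ 2 - x := by
  rcases hx.eq_or_lt with rfl | hx
  · simp [sq_nonneg]
  · have h1 := log_le_sub_one_of_pos (show 0 < b ^ 2 / x by positivity)
    rw [log_div (by positivity) hx.ne', log_pow] at h1
    push_cast at h1
    have h2 := mul_le_mul_of_nonneg_left h1 hx.le
    have h3 : x * (b ^ 2 / x - 1) = b ^ 2 - x := by
      field_simp
    linarith

namespace IsotropicLogConcaveOn

variable {n : ℕ} {μ : Measure (EuclideanSpace ℝ (Fin n))}
  {p : EuclideanSpace ℝ (Fin n) → ℝ} {D t : ℝ}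

theorem continuous_integral_right (h : IsotropicLogConcaveOn μ p D)
    {φ : EuclideanSpace ℝ (Fin n) → EuclideanSpace ℝ (Fin n) → ℝ}
    (hφ : Continuous (Function.uncurry φ)) : Continuous fun x => ∫ y, φ x y ∂μ := by
  have := h.prob
  have h1 : μ.restrict (Metric.closedBall 0 D) = μ :=
    Measure.restrict_eq_self_of_ae_mem (by simpa using h.ae_norm_le)
  rw [← h1]
  exact continuous_parametric_integral_of_continuous hφ (isCompact_closedBall _ _)

theorem integral_sq_integral_mul_exp_inner_le (h : IsotropicLogConcaveOn μ p D) (ht : 0 ≤ t)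
    (htD : t * D ≤ 1 / 3200) {g : EuclideanSpace ℝ (Fin n) → ℝ} (hg : Continuous g)
    (hg0 : ∀ x, 0 ≤ g x) (hg1 : ∫ x, g x ∂μ = 1) :
    ∫ x, (∫ y, g y * exp (t * ⟪x, y⟫_ℝ) ∂μ) ^ 2 ∂μ ≤ 1 + 1 / 40 := by
  have := h.prob
  have hc : Continuous fun x => ∫ y, g y * exp (t * ⟪x, y⟫_ℝ) ∂μ :=
    h.continuous_integral_right (φ := fun x y => g y * exp (t * ⟪x, y⟫_ℝ))
      (by unfold Function.uncurry; fun_prop)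
  have hc2 : Continuous fun x => ∫ y, g y * exp (t * ⟪x, y⟫_ℝ) ^ 2 ∂μ :=
    h.continuous_integral_right (φ := fun x y => g y * exp (t * ⟪x, y⟫_ℝ) ^ 2)
      (by unfold Function.uncurry; fun_prop)
  have h1 : ∀ x, (∫ y, g y * exp (t * ⟪x, y⟫_ℝ) ∂μ) ^ 2 ≤ ∫ y, g y * exp (t * ⟪x, y⟫_ℝ) ^ 2 ∂μ := by
    intro x
    set c := ∫ y, g y * exp (t * ⟪x, y⟫_ℝ) ∂μ with hc
    have h2 : 0 ≤ ∫ y, g y * (exp (t * ⟪x, y⟫_ℝ) - c) ^ 2 ∂μ :=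
      integral_nonneg fun y => mul_nonneg (hg0 y) (sq_nonneg _)
    have h3 : ∫ y, g y * (exp (t * ⟪x, y⟫_ℝ) - c) ^ 2 ∂μ =
        ∫ y, g y * exp (t * ⟪x, y⟫_ℝ) ^ 2 ∂μ - 2 * c * c + c ^ 2 * 1 := by
      have h4 : ∫ y, g y * (exp (t * ⟪x, y⟫_ℝ) - c) ^ 2 ∂μ = ∫ y, (g y * exp (t * ⟪x, y⟫_ℝ) ^ 2 -
          2 * c * (g y * exp (t * ⟪x, y⟫_ℝ)) + c ^ 2 * g y) ∂μ := by
        congr 1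
        ext y
        ring
      rw [h4, integral_add (h.integrable (by fun_prop)) (h.integrable (by fun_prop)),
        integral_sub (h.integrable (by fun_prop)) (h.integrable (by fun_prop)),
        integral_const_mul, integral_const_mul, hg1, ← hc]
    nlinarith
  calc _ ≤ ∫ x, ∫ y, g y * exp (t * ⟪x, y⟫_ℝ) ^ 2 ∂μ ∂μ :=
        integral_mono (h.integrable (hc.pow 2)) (h.integrable hc2) h1
    _ = ∫ y, ∫ x, g y * exp (t * ⟪x, y⟫_ℝ) ^ 2 ∂μ ∂μ :=
        integral_integral_swap (f := fun x y => g y * exp (t * ⟪x, y⟫_ℝ) ^ 2)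
          (h.integrable_prod (by unfold Function.uncurry; fun_prop))
    _ ≤ ∫ y, g y * (1 + 1 / 40) ∂μ := by
        refine integral_mono_of_nonneg (ae_of_all _ fun y => ?_) (h.integrable (by fun_prop)) ?_
        · exact integral_nonneg fun x => mul_nonneg (hg0 y) (sq_nonneg _)
        · filter_upwards [h.ae_norm_le] with y hy
          rw [integral_const_mul]
          simp only [real_inner_comm y]
          exact mul_le_mul_of_nonneg_left (h.integral_exp_two_mul_inner_le ht htD hy) (hg0 y)
    _ = _ := by rw [integral_mul_const, hg1, one_mul]

theorem defective_log_sobolev (h : IsotropicLogConcaveOn μ p D) (ht : 0 < t)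
    (htD : t * D ≤ 1 / 3200) {f : EuclideanSpace ℝ (Fin n) → ℝ} (hf : ContDiff ℝ (⊤ : ℕ∞) f)
    (hf1 : ∫ x, f x ^ 2 ∂μ = 1) :
    ∫ x, f x ^ 2 * log (f x ^ 2) ∂μ ≤ 13 + 8 / t * ∫ x, ‖gradient f x‖ ^ 2 ∂μ := by
  have := h.prob
  have hfc := hf.continuous
  have hfg := hf.continuous_gradient'
  have hflog := continuous_sq_mul_log_sq hfc
  set S := {ω | 1 / 2 ≤ ∫ x, tilt t ω x ∂μ} with hS
  have hSm : MeasurableSet S := h.measurableSet_half_le_integral_tilt t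
  set c : EuclideanSpace ℝ (Fin n) → ℝ := fun x => ∫ y, f y ^ 2 * exp (t * ⟪x, y⟫_ℝ) ∂μ with hc
  have hc0 : ∀ x, 0 ≤ c x := fun x => integral_nonneg fun y => by positivity
  have hcc : Continuous c :=
    h.continuous_integral_right (φ := fun x y => f y ^ 2 * exp (t * ⟪x, y⟫_ℝ))
      (by unfold Function.uncurry; fun_prop)
  have hcsq : ∫ x, c x ^ 2 ∂μ ≤ 1 + 1 / 40 :=
    h.integral_sq_integral_mul_exp_inner_le ht.le htD (by fun_prop) (fun x => sq_nonneg _) hf1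
  set b : EuclideanSpace ℝ (Fin n) → ℝ := fun x => 1 + c x with hb
  have hb1 : ∀ x, 1 ≤ b x := fun x => by linarith [hc0 x]
  have hbp : ∀ x, 0 < b x := fun x => by linarith [hb1 x]
  have hbc : Continuous b := by fun_prop
  have hblog : Continuous fun x => log (b x) := hbc.log fun x => (hbp x).ne'
  have hbinv : Continuous fun x => (b x)⁻¹ := hbc.inv₀ fun x => (hbp x).ne'
  have hbsq : ∫ x, b x ^ 2 ∂μ ≤ 5 := by
    calc ∫ x, b x ^ 2 ∂μ ≤ ∫ x, (2 + 2 * c x ^ 2) ∂μ := by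
          refine integral_mono (h.integrable (by fun_prop)) (h.integrable (by fun_prop)) fun x => ?_
          have := sq_nonneg (1 - c x)
          simp only [hb]
          nlinarith
      _ ≤ 5 := by
          rw [integral_add (integrable_const _) (h.integrable (by fun_prop)), integral_const_mul]
          simp
          linarith
  set φ₁ : EuclideanSpace ℝ (Fin n) → ℝ := fun x =>
    f x ^ 2 * log (f x ^ 2) - f x ^ 2 * log (b x) + (1 - log 2) * f x ^ 2 with hφ₁
  set φ₂ : EuclideanSpace ℝ (Fin n) × EuclideanSpace ℝ (Fin n) → ℝ := fun z =>
    f z.1 ^ 2 * (b z.1)⁻¹ * f z.2 ^ 2 with hφ₂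
  have hφ₁c : Continuous φ₁ := by fun_prop
  have hφ₂c : Continuous φ₂ := by
    have : Continuous fun z : EuclideanSpace ℝ (Fin n) × EuclideanSpace ℝ (Fin n) => (b z.1)⁻¹ :=
      hbinv.comp continuous_fst
    fun_prop
  have hφ₂0 : ∀ z, 0 ≤ φ₂ z := fun z => by
    have := (hbp z.1).le
    positivity
  have e : ∀ ω, ∫ x, f x ^ 2 * (log (f x ^ 2) - log (b x) - (∫ y, f y ^ 2 * tilt t ω y ∂μ) / b x
      + 1 - log 2) * tilt t ω x ∂μ =
      ∫ x, φ₁ x * tilt t ω x ∂μ - ∫ z, φ₂ z * (tilt t ω z.1 * tilt t ω z.2) ∂μ.prod μ := by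
    intro ω
    have e1 : ∫ z, φ₂ z * (tilt t ω z.1 * tilt t ω z.2) ∂μ.prod μ =
        ∫ x, f x ^ 2 * (b x)⁻¹ * tilt t ω x * (∫ y, f y ^ 2 * tilt t ω y ∂μ) ∂μ := by
      rw [integral_mul_const, ← integral_prod_mul]
      congr 1
      ext z
      simp only [hφ₂]
      ring
    rw [e1, ← integral_sub (h.integrable (by fun_prop)) (h.integrable (by fun_prop))]
    congr 1
    ext x
    simp only [hφ₁]
    ring
  have i1 := h.integrable_integral_mul_tilt ht.le hφ₁c
  have i2 := h.integrable_integral_mul_tilt_mul_tilt ht.le hφ₂c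
  have i3 := h.integrable_integral_mul_tilt ht.le (φ := fun x => ‖gradient f x‖ ^ 2) (by fun_prop)
  have H : ∫ ω in S, (∫ x, φ₁ x * tilt t ω x ∂μ -
      ∫ z, φ₂ z * (tilt t ω z.1 * tilt t ω z.2) ∂μ.prod μ) ∂stdGauss n ≤
      ∫ ω in S, 2 / t * ∫ x, ‖gradient f x‖ ^ 2 * tilt t ω x ∂μ ∂stdGauss n :=
    setIntegral_mono_on (i1.sub i2).integrableOn (i3.const_mul _).integrableOn hSm
      fun ω hω => (e ω) ▸ h.integral_mul_tilt_le ht hω hf hbc hbp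
  rw [integral_sub i1.integrableOn i2.integrableOn,
    integral_const_mul, h.setIntegral_integral_mul_tilt ht.le hφ₁c,
    h.setIntegral_integral_mul_tilt ht.le (φ := fun x => ‖gradient f x‖ ^ 2) (by fun_prop)] at H
  have b1 : ∫ ω in S, ∫ z, φ₂ z * (tilt t ω z.1 * tilt t ω z.2) ∂μ.prod μ ∂stdGauss n ≤ 1 := by
    refine (setIntegral_le_integral i2 (ae_of_all _ fun ω => integral_nonneg fun z =>
      mul_nonneg (hφ₂0 z) (mul_pos (tilt_pos _ _ _) (tilt_pos _ _ _)).le)).trans ?_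
    rw [h.integral_integral_mul_tilt_mul_tilt ht.le hφ₂c,
      integral_prod _ (h.integrable_prod (by fun_prop)), ← hf1]
    have e2 : ∀ x, ∫ y, φ₂ (x, y) * exp (t * ⟪x, y⟫_ℝ) ∂μ = f x ^ 2 * ((b x)⁻¹ * c x) := fun x => by
      simp only [hφ₂, mul_assoc, integral_const_mul, hc]
    simp only [e2]
    refine integral_mono (h.integrable (by fun_prop)) (h.integrable (by fun_prop)) fun x => ?_
    refine mul_le_of_le_one_right (sq_nonneg _) ?_
    rw [inv_mul_le_one₀ (hbp x)]
    simp only [hb]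
    linarith
  have b3 := h.integral_mul_setIntegral_tilt_le ht.le (φ := fun x => ‖gradient f x‖ ^ 2)
    (by fun_prop) (fun x => sq_nonneg _) S
  have b2 : 3 / 4 * ∫ x, f x ^ 2 * log (f x ^ 2) ∂μ - 1 / 4 -
      (∫ x, f x ^ 2 * log (f x ^ 2) ∂μ + 5 - 1) / 2 ≤
      ∫ x, φ₁ x * ∫ ω in S, tilt t ω x ∂stdGauss n ∂μ := by
    have hlog2 : log 2 ≤ 1 := by linarith [log_two_lt_d9]
    have h1 : ∫ x, (3 / 4 * (f x ^ 2 * log (f x ^ 2)) - 1 / 4 -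
        1 / 2 * (f x ^ 2 * log (f x ^ 2) + b x ^ 2 - f x ^ 2)) ∂μ ≤
        ∫ x, φ₁ x * ∫ ω in S, tilt t ω x ∂stdGauss n ∂μ := by
      refine integral_mono_ae (h.integrable (by fun_prop))
        (h.integrable_mul_setIntegral_tilt ht.le hφ₁c S) ?_
      filter_upwards [h.ae_norm_le] with x hx
      have s1 := setIntegral_tilt_le_one ht.le S x
      have s2 := h.le_setIntegral_tilt ht.le htD hx
      rw [← hS] at s2
      set s := ∫ ω in S, tilt t ω x ∂stdGauss n
      have g0 := sq_nonneg (f x)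
      have l1 := sub_one_le_mul_log g0
      have l2 := two_mul_mul_log_le g0 (hbp x)
      have l3 : 0 ≤ f x ^ 2 * log (b x) := mul_nonneg g0 (log_nonneg (hb1 x))
      simp only [hφ₁]
      set G := f x ^ 2 * log (f x ^ 2)
      set L := f x ^ 2 * log (b x)
      have m1 : 0 ≤ (1 - log 2) * f x ^ 2 * s :=
        mul_nonneg (mul_nonneg (by linarith) g0) (by linarith)
      have m2 : L * s ≤ L := mul_le_of_le_one_right l3 s1
      have m3 : 0 ≤ (G + 1) * (s - 3 / 4) := mul_nonneg (by linarith) (by linarith)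
      nlinarith
    refine le_trans ?_ h1
    rw [integral_sub (h.integrable (by fun_prop)) (h.integrable (by fun_prop)),
      integral_sub (h.integrable (by fun_prop)) (h.integrable (by fun_prop)),
      integral_const_mul, integral_const_mul,
      integral_sub (h.integrable (by fun_prop)) (h.integrable (by fun_prop)),
      integral_add (h.integrable (by fun_prop)) (h.integrable (by fun_prop)), hf1]
    simp
    linarith
  have b5 := mul_le_mul_of_nonneg_left b3 (by positivity : 0 ≤ 2 / t)
  have e8 : 8 / t * ∫ x, ‖gradient f x‖ ^ 2 ∂μ = 4 * (2 / t * ∫ x, ‖gradient f x‖ ^ 2 ∂μ) := by ring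
  linarith

end IsotropicLogConcaveOn

theorem sq_mul_log_sub_sq_add_one_le (u : ℝ) :
    (1 + u) ^ 2 * log ((1 + u) ^ 2) - (1 + u) ^ 2 + 1 ≤ 9 * u ^ 2 + 4 * (u ^ 2 * max 0 (log (u ^ 2))) := by
  have hX := sq_nonneg (1 + u)
  rcases le_or_gt |u| 1 with hu | hu
  · have h1 : (1 + u) ^ 2 * log ((1 + u) ^ 2) ≤ (1 + u) ^ 2 * ((1 + u) ^ 2 - 1) := by
      rcases hX.eq_or_lt with h0 | h0
      · rw [← h0]
        simp
      · exact mul_le_mul_of_nonneg_left (log_le_sub_one_of_pos h0) hX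
    have h2 : 0 ≤ u ^ 2 * max 0 (log (u ^ 2)) := by positivity
    obtain ⟨h3, h4⟩ := abs_le.1 hu
    have h5 : ((1 + u) ^ 2 - 1) ^ 2 = u ^ 2 * (2 + u) ^ 2 := by ring
    have h6 : (2 + u) ^ 2 ≤ 9 := by nlinarith
    nlinarith [mul_le_mul_of_nonneg_left h6 (sq_nonneg u)]
  · have h1 : 1 < u ^ 2 := by
      rw [← sq_abs]
      nlinarith
    have h2 : (1 + u) ^ 2 ≤ 4 * u ^ 2 := by nlinarith [sq_nonneg (1 - u)]
    have h3 : (1 + u) ^ 2 * log ((1 + u) ^ 2) ≤ (1 + u) ^ 2 * log (4 * u ^ 2) := by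
      rcases hX.eq_or_lt with h0 | h0
      · rw [← h0]
        simp
      · exact mul_le_mul_of_nonneg_left (log_le_log h0 h2) hX
    have h4 : log (4 * u ^ 2) = 2 * log 2 + log (u ^ 2) := by
      rw [log_mul (by norm_num) (by positivity), show (4 : ℝ) = 2 ^ 2 by norm_num, log_pow]
      norm_num
    have h5 : 0 < log (u ^ 2) := log_pos h1
    have h6 := mul_le_mul_of_nonneg_right h2 (show 0 ≤ log (4 * u ^ 2) by
      linarith [log_two_gt_d9])
    have h7 := log_two_lt_d9
    rw [max_eq_right h5.le]
    rw [h4] at h3 h6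
    nlinarith

theorem sq_add_mul_log_sub_le {a V : ℝ} (hV : 0 < V) (hVa : V ≤ a ^ 2) (y : ℝ) :
    (y + a) ^ 2 * log ((y + a) ^ 2) - (y + a) ^ 2 * log (a ^ 2) - (y + a) ^ 2 + a ^ 2 ≤
      9 * y ^ 2 + 4 * V + 4 * (y ^ 2 * log (y ^ 2) - y ^ 2 * log V) := by
  have ha2 : 0 < a ^ 2 := hV.trans_le hVa
  have ha : a ≠ 0 := by
    rintro rfl
    simp at ha2
  obtain ⟨u, rfl⟩ : ∃ u, y = a * u := ⟨y / a, by field_simp⟩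
  have e1 : (a * u + a) ^ 2 * log ((a * u + a) ^ 2) - (a * u + a) ^ 2 * log (a ^ 2) =
      a ^ 2 * ((1 + u) ^ 2 * log ((1 + u) ^ 2)) := by
    have : (a * u + a) ^ 2 = a ^ 2 * (1 + u) ^ 2 := by ring
    rw [this]
    rcases (sq_nonneg (1 + u)).eq_or_lt with h0 | h0
    · rw [← h0]
      simp
    · rw [log_mul ha2.ne' h0.ne']
      ring
  have e2 : (a * u) ^ 2 * max 0 (log (u ^ 2)) ≤
      V + ((a * u) ^ 2 * log ((a * u) ^ 2) - (a * u) ^ 2 * log V) := by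
    rcases eq_or_ne u 0 with rfl | hu
    · simpa using hV.le
    have hu2 : 0 < u ^ 2 := by positivity
    have hau : 0 < (a * u) ^ 2 := by positivity
    rw [← mul_sub, ← log_div hau.ne' hV.ne']
    rcases le_or_gt 0 (log (u ^ 2)) with hl | hl
    · rw [max_eq_right hl]
      have h1 : u ^ 2 ≤ (a * u) ^ 2 / V := by
        rw [le_div_iff₀ hV, mul_pow]
        nlinarith
      have := mul_le_mul_of_nonneg_left (log_le_log hu2 h1) hau.le
      linarith
    · rw [max_eq_left hl.le]
      have h1 := mul_le_mul_of_nonneg_left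
        (sub_one_le_mul_log (show 0 ≤ (a * u) ^ 2 / V by positivity)) hV.le
      have h2 : V * ((a * u) ^ 2 / V - 1) = (a * u) ^ 2 - V := by field_simp
      have h3 : V * ((a * u) ^ 2 / V * log ((a * u) ^ 2 / V)) =
        (a * u) ^ 2 * log ((a * u) ^ 2 / V) := by field_simp
      rw [h2, h3] at h1
      linarith
  have h := mul_le_mul_of_nonneg_left (sq_mul_log_sub_sq_add_one_le u) ha2.le
  rw [e1]
  have e3 : a ^ 2 * (9 * u ^ 2 + 4 * (u ^ 2 * max 0 (log (u ^ 2)))) =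
      9 * (a * u) ^ 2 + 4 * ((a * u) ^ 2 * max 0 (log (u ^ 2))) := by ring
  have e4 : (a * u + a) ^ 2 = a ^ 2 * (1 + u) ^ 2 := by ring
  rw [e3] at h
  rw [e4]
  linarith

theorem gradient_sub_const' {n : ℕ} (f : EuclideanSpace ℝ (Fin n) → ℝ) (a : ℝ)
    (x : EuclideanSpace ℝ (Fin n)) : gradient (fun x => f x - a) x = gradient f x := by
  simp only [gradient, fderiv_sub_const]

theorem norm_gradient_const_mul {n : ℕ} {f : EuclideanSpace ℝ (Fin n) → ℝ} (a : ℝ)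
    {x : EuclideanSpace ℝ (Fin n)} (hf : DifferentiableAt ℝ f x) :
    ‖gradient (fun x => a * f x) x‖ = |a| * ‖gradient f x‖ := by
  simp only [gradient, fderiv_const_mul hf a, map_smul, norm_smul, LinearIsometryEquiv.norm_map,
    Real.norm_eq_abs]

namespace IsotropicLogConcaveOn

variable {n : ℕ} {μ : Measure (EuclideanSpace ℝ (Fin n))}
  {p : EuclideanSpace ℝ (Fin n) → ℝ} {D t : ℝ}

/-- The homogeneous form of the defective log-Sobolev inequality. -/
theorem defective_log_sobolev_of_pos (h : IsotropicLogConcaveOn μ p D) (ht : 0 < t)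
    (htD : t * D ≤ 1 / 3200) {f : EuclideanSpace ℝ (Fin n) → ℝ} (hf : ContDiff ℝ (⊤ : ℕ∞) f)
    {V : ℝ} (hV : 0 < V) (hfV : ∫ x, f x ^ 2 ∂μ = V) :
    ∫ x, (f x ^ 2 * log (f x ^ 2) - f x ^ 2 * log V) ∂μ ≤
      13 * V + 8 / t * ∫ x, ‖gradient f x‖ ^ 2 ∂μ := by
  have hk : ContDiff ℝ (⊤ : ℕ∞) fun x => (√V)⁻¹ * f x := contDiff_const.mul hf
  have e0 : (√V)⁻¹ ^ 2 = V⁻¹ := by rw [inv_pow, sq_sqrt hV.le]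
  have H := h.defective_log_sobolev ht htD hk (by
    simp only [mul_pow, e0]
    rw [integral_const_mul, hfV, inv_mul_cancel₀ hV.ne'])
  have e1 : ∀ x, ((√V)⁻¹ * f x) ^ 2 * log (((√V)⁻¹ * f x) ^ 2) =
      V⁻¹ * (f x ^ 2 * log (f x ^ 2) - f x ^ 2 * log V) := by
    intro x
    rw [mul_pow, e0]
    rcases (sq_nonneg (f x)).eq_or_lt with h0 | h0
    · rw [← h0]
      simp
    · rw [log_mul (inv_pos.2 hV).ne' h0.ne', log_inv]
      ring
  have e2 : ∀ x, ‖gradient (fun x => (√V)⁻¹ * f x) x‖ ^ 2 = V⁻¹ * ‖gradient f x‖ ^ 2 := by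
    intro x
    rw [norm_gradient_const_mul _ (hf.differentiable (by simp) x), mul_pow, sq_abs, e0]
  simp only [e1, e2, integral_const_mul] at H
  have H' := mul_le_mul_of_nonneg_left H hV.le
  rw [mul_inv_cancel_left₀ hV.ne'] at H'
  refine H'.trans (le_of_eq ?_)
  field_simp

theorem log_sobolev (h : IsotropicLogConcaveOn μ p D) (ht : 0 < t)
    (htD : t * D ≤ 1 / 3200) {f : EuclideanSpace ℝ (Fin n) → ℝ} (hf : ContDiff ℝ (⊤ : ℕ∞) f)
    (hf1 : ∫ x, f x ^ 2 ∂μ = 1) :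
    ∫ x, f x ^ 2 * log (f x ^ 2) ∂μ ≤ 552 / t * ∫ x, ‖gradient f x‖ ^ 2 ∂μ := by
  have := h.prob
  have hfc := hf.continuous
  have hflog := continuous_sq_mul_log_sq hfc
  set I := ∫ x, ‖gradient f x‖ ^ 2 ∂μ with hI
  have hI0 : 0 ≤ I := integral_nonneg fun x => sq_nonneg _
  have hIt : 0 ≤ 1 / t * I := by positivity
  have s8 : 8 / t * I = 8 * (1 / t * I) := by ring
  have s552 : 552 / t * I = 552 * (1 / t * I) := by ring
  set a := ∫ x, f x ∂μ with ha
  have hgs : ContDiff ℝ (⊤ : ℕ∞) fun x => f x - a := hf.sub contDiff_const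
  have hgc := hgs.continuous
  have hg0 : ∫ x, (f x - a) ∂μ = 0 := by
    rw [integral_sub (h.integrable hfc) (integrable_const _)]
    simp [ha]
  have hgP := h.poincare ht htD hgs hg0
  have hgD := h.defective_log_sobolev_of_pos ht htD hgs (V := ∫ x, (f x - a) ^ 2 ∂μ)
  simp only [gradient_sub_const', ← hI, s8] at hgP hgD
  have hVa : ∫ x, (f x - a) ^ 2 ∂μ = 1 - a ^ 2 := by
    have e : ∀ x, (f x - a) ^ 2 = f x ^ 2 - 2 * a * (f x - a) - a ^ 2 := fun x => by ring
    simp only [e]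
    rw [integral_sub (h.integrable (by fun_prop)) (integrable_const _),
      integral_sub (h.integrable (by fun_prop)) (h.integrable (by fun_prop)),
      integral_const_mul, hg0, hf1]
    simp
  set V := ∫ x, (f x - a) ^ 2 ∂μ with hV
  have hV0 : 0 ≤ V := integral_nonneg fun x => sq_nonneg _
  rw [s552]
  rcases le_or_gt (1 / 2) V with hV2 | hV2
  · have := h.defective_log_sobolev ht htD hf hf1
    rw [← hI, s8] at this
    linarith
  rcases hV0.eq_or_lt with h0 | h0
  · have hz : (fun x => (f x - a) ^ 2) =ᵐ[μ] 0 := (integral_eq_zero_iff_of_nonneg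
      (fun x => sq_nonneg _) (h.integrable (hgc.pow 2))).1 h0.symm
    have ha1 : a ^ 2 = 1 := by linarith
    have : ∫ x, f x ^ 2 * log (f x ^ 2) ∂μ = 0 := by
      refine integral_eq_zero_of_ae ?_
      filter_upwards [hz] with x hx
      have : f x = a := by simpa [sub_eq_zero] using hx
      simp only [this, ha1, log_one, mul_zero, Pi.zero_apply]
    linarith
  · have hglog := continuous_sq_mul_log_sq hgc
    have hga := hgD h0 trivial
    have h1 : ∫ x, (f x ^ 2 * log (f x ^ 2) - f x ^ 2 * log (a ^ 2) - f x ^ 2 + a ^ 2) ∂μ ≤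
        ∫ x, (9 * (f x - a) ^ 2 + 4 * V +
          4 * ((f x - a) ^ 2 * log ((f x - a) ^ 2) - (f x - a) ^ 2 * log V)) ∂μ := by
      refine integral_mono (h.integrable (by fun_prop)) (h.integrable (by fun_prop)) fun x => ?_
      have := sq_add_mul_log_sub_le h0 (show V ≤ a ^ 2 by linarith) (f x - a)
      simpa only [sub_add_cancel] using this
    rw [integral_add (h.integrable (by fun_prop)) (integrable_const _),
      integral_sub (h.integrable (by fun_prop)) (h.integrable (by fun_prop)),
      integral_sub (h.integrable (by fun_prop)) (h.integrable (by fun_prop)),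
      integral_mul_const, hf1,
      integral_add (h.integrable (by fun_prop)) (h.integrable (by fun_prop)),
      integral_add (h.integrable (by fun_prop)) (integrable_const _),
      integral_const_mul, ← hV] at h1
    simp only [integral_const, probReal_univ, smul_eq_mul, one_mul, integral_const_mul] at h1
    have h2 := log_le_sub_one_of_pos (show 0 < a ^ 2 by linarith)
    linarith

end IsotropicLogConcaveOn

section Density

variable {n : ℕ} {p : EuclideanSpace ℝ (Fin n) → ℝ} {D : ℝ}

theorem IsLogConcave.concaveOn_log (hp : IsLogConcave p) :
    ConcaveOn ℝ {x | 0 < p x} fun x => log (p x) := by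
  have key : ∀ ⦃x⦄, 0 < p x → ∀ ⦃y⦄, 0 < p y → ∀ ⦃a b : ℝ⦄, 0 ≤ a → 0 ≤ b → a + b = 1 →
      p x ^ a * p y ^ b ≤ p (a • x + b • y) := by
    intro x _ y _ a b ha hb hab
    obtain rfl : b = 1 - a := by linarith
    exact hp x y a ha (by linarith)
  refine ⟨fun x hx y hy a b ha hb hab => ?_, fun x hx y hy a b ha hb hab => ?_⟩
  · exact (mul_pos (rpow_pos_of_pos hx _) (rpow_pos_of_pos hy _)).trans_le (key hx hy ha hb hab)
  · have := log_le_log (mul_pos (rpow_pos_of_pos hx _) (rpow_pos_of_pos hy _)) (key hx hy ha hb hab)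
    rw [log_mul (rpow_pos_of_pos hx _).ne' (rpow_pos_of_pos hy _).ne', log_rpow hx,
      log_rpow hy] at this
    simpa using this

theorem IsLogConcave.measurable_indicator (hp : IsLogConcave p) :
    Measurable ((interior {x | 0 < p x}).indicator p) := by
  have h1 : ContinuousOn p (interior {x | 0 < p x}) := by
    refine hp.concaveOn_log.continuousOn_interior.rexp.congr fun x hx => ?_
    have hx' : x ∈ {x | 0 < p x} := interior_subset hx
    exact (exp_log hx').symm
  classical
  rw [← Set.piecewise_eq_indicator]
  exact h1.measurable_piecewise continuousOn_const isOpen_interior.measurableSet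

theorem IsLogConcave.indicator_ae_eq (hp : IsLogConcave p) (h0 : ∀ x, 0 ≤ p x) :
    (interior {x | 0 < p x}).indicator p =ᵐ[volume] p := by
  have h1 : volume (frontier {x | 0 < p x}) = 0 := hp.concaveOn_log.1.addHaar_frontier _
  filter_upwards [measure_eq_zero_iff_ae_notMem.1 h1] with x hx
  by_cases hxi : x ∈ interior {x | 0 < p x}
  · rw [Set.indicator_of_mem hxi]
  · rw [Set.indicator_of_notMem hxi]
    by_contra hne
    have : x ∈ {x | 0 < p x} := lt_of_le_of_ne (h0 x) hne
    exact hx ⟨subset_closure this, hxi⟩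

theorem IsDensity.norm_le (hp : IsDensity p) (hiso : IsIsotropic p)
    (hD : ∀ x y, 0 < p x → 0 < p y → dist x y ≤ D) {x : EuclideanSpace ℝ (Fin n)}
    (hx : 0 < p x) : ‖x‖ ≤ D := by
  obtain ⟨h0, hi, h1⟩ := hp
  have hb : ∀ y, ‖p y • (x - y)‖ ≤ p y * D := fun y => by
    rw [norm_smul, Real.norm_of_nonneg (h0 y), ← dist_eq_norm]
    rcases (h0 y).eq_or_lt with h | h
    · simp [← h]
    · exact mul_le_mul_of_nonneg_left (hD x y hx h) (h0 y)
  have hi1 : Integrable fun y => p y • (x - y) :=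
    (hi.mul_const D).mono' (hi.1.smul (by fun_prop)) (ae_of_all _ hb)
  have hi2 : Integrable fun y => p y • x := hi.smul_const x
  have e : ∫ y, p y • (x - y) = x := by
    have hi3 : Integrable fun y => p y • y := by
      refine (hi2.sub hi1).congr (ae_of_all _ fun y => ?_)
      simp [smul_sub]
    simp only [smul_sub]
    rw [integral_sub hi2 hi3, hiso.1, integral_smul_const, h1]
    simp
  calc ‖x‖ = ‖∫ y, p y • (x - y)‖ := by rw [e]
    _ ≤ ∫ y, p y * D := norm_integral_le_of_norm_le (hi.mul_const D) (ae_of_all _ hb)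
    _ = D := by rw [integral_mul_const, h1, one_mul]

theorem IsDensity.integral_withDensity (hp : IsDensity p) (φ : EuclideanSpace ℝ (Fin n) → ℝ) :
    ∫ x, φ x ∂(volume.withDensity fun x => ENNReal.ofReal (p x)) = ∫ x, φ x * p x := by
  have hm : AEMeasurable (fun x => ENNReal.ofReal (p x)) volume :=
    hp.2.1.1.aemeasurable.ennreal_ofReal
  rw [integral_withDensity_eq_integral_toReal_smul₀ hm (ae_of_all _ fun x => by simp)]
  refine integral_congr_ae (ae_of_all _ fun x => ?_)
  simp [ENNReal.toReal_ofReal (hp.1 x), mul_comm]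

theorem IsDensity.integrable_mul (hp : IsDensity p) (hD : ∀ x, 0 < p x → ‖x‖ ≤ D)
    {φ : EuclideanSpace ℝ (Fin n) → ℝ} (hφ : Continuous φ) : Integrable fun x => p x * φ x := by
  obtain ⟨C, hC⟩ := (isCompact_closedBall (0 : EuclideanSpace ℝ (Fin n)) D).exists_bound_of_continuousOn
    hφ.continuousOn
  refine (hp.2.1.mul_const C).mono' (hp.2.1.1.mul (by fun_prop)) (ae_of_all _ fun x => ?_)
  rw [norm_mul, Real.norm_of_nonneg (hp.1 x)]
  rcases (hp.1 x).eq_or_lt with h | h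
  · simp [← h]
  · exact mul_le_mul_of_nonneg_left (hC x (by simpa using hD x h)) (hp.1 x)

theorem IsDensity.isotropicLogConcaveOn (hp : IsDensity p) (hlc : IsLogConcave p)
    (hiso : IsIsotropic p) (hD : ∀ x y, 0 < p x → 0 < p y → dist x y ≤ D) :
    IsotropicLogConcaveOn (volume.withDensity fun x => ENNReal.ofReal (p x))
      ((interior {x | 0 < p x}).indicator p) D := by
  have hDn : ∀ x, 0 < p x → ‖x‖ ≤ D := fun x => hp.norm_le hiso hD
  have hpos : ∀ {x}, x ∈ interior {x | 0 < p x} → 0 < p x := fun {x} hx =>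
    show x ∈ {x | 0 < p x} from interior_subset hx
  refine ⟨hlc.measurable_indicator, fun x => Set.indicator_nonneg (fun x _ => hp.1 x) x,
    fun x y l hl0 hl1 => ?_, fun x hx => ?_, ?_, ⟨?_⟩, fun v => ?_, fun v => ?_⟩
  · by_cases hx : x ∈ interior {x | 0 < p x}
    · by_cases hy : y ∈ interior {x | 0 < p x}
      · rw [Set.indicator_of_mem hx, Set.indicator_of_mem hy, Set.indicator_of_mem
          (hlc.concaveOn_log.1.interior hx hy hl0.le (by linarith) (by ring))]
        exact hlc x y l hl0.le hl1.le
      · rw [Set.indicator_of_notMem hy, zero_rpow (by linarith), mul_zero]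
        exact Set.indicator_nonneg (fun x _ => hp.1 x) _
    · rw [Set.indicator_of_notMem hx, zero_rpow hl0.ne', zero_mul]
      exact Set.indicator_nonneg (fun x _ => hp.1 x) _
  · exact hDn x (hpos (Set.mem_of_indicator_ne_zero hx.ne'))
  · refine withDensity_congr_ae ?_
    filter_upwards [hlc.indicator_ae_eq hp.1] with x hx
    rw [hx]
  · rw [withDensity_apply _ MeasurableSet.univ, Measure.restrict_univ,
      ← ofReal_integral_eq_lintegral_ofReal hp.2.1 (ae_of_all _ hp.1), hp.2.2, ENNReal.ofReal_one]
  · have hi : Integrable fun x => p x • x := by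
      refine (hp.2.1.mul_const D).mono' (hp.2.1.1.smul (by fun_prop)) (ae_of_all _ fun x => ?_)
      rw [norm_smul, Real.norm_of_nonneg (hp.1 x)]
      rcases (hp.1 x).eq_or_lt with h | h
      · simp [← h]
      · exact mul_le_mul_of_nonneg_left (hDn x h) (hp.1 x)
    have := integral_inner (𝕜 := ℝ) hi v
    rw [hiso.1, inner_zero_right] at this
    rw [hp.integral_withDensity, ← this]
    simp only [real_inner_smul_right, mul_comm]
  · rw [hp.integral_withDensity]
    have e : ∀ x, ⟪v, x⟫_ℝ ^ 2 * p x = ∑ i, ∑ j, v i * v j * (p x * (x i * x j)) := by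
      intro x
      rw [PiLp.inner_apply, sq, Finset.sum_mul_sum, Finset.sum_mul]
      refine Finset.sum_congr rfl fun i _ => ?_
      rw [Finset.sum_mul]
      refine Finset.sum_congr rfl fun j _ => ?_
      simp
      ring
    simp only [e]
    have hi : ∀ i j, Integrable fun x => v i * v j * (p x * (x i * x j)) := fun i j =>
      (hp.integrable_mul hDn (φ := fun x => x i * x j) (by fun_prop)).const_mul _
    rw [integral_finsetSum _ fun i _ => integrable_finsetSum _ fun j _ => hi i j]
    simp only [integral_finsetSum _ fun j _ => hi _ j, integral_const_mul, hiso.2]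
    rw [EuclideanSpace.real_norm_sq_eq]
    simp [sq]

end Density

/-- Lee–Vempala, tight log-Sobolev: there is a universal constant `c > 0`
such that every isotropic logconcave density `p` on `ℝⁿ` with support of diameter at most
`D` satisfies the log-Sobolev inequality with constant `c/D`: for all smooth `f` with
`∫ f² p = 1`, `∫ ‖∇f‖² p ≥ (c/D) ∫ f² log(f²) p`. -/
theorem log_sobolev_diameter :
    ∃ c : ℝ, 0 < c ∧
      ∀ (n : ℕ) (p : EuclideanSpace ℝ (Fin n) → ℝ) (D : ℝ),
        IsDensity p → IsLogConcave p → IsIsotropic p → 0 < D →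
        (∀ x y, 0 < p x → 0 < p y → dist x y ≤ D) →
        ∀ f : EuclideanSpace ℝ (Fin n) → ℝ, ContDiff ℝ (⊤ : ℕ∞) f →
          (∫ x, (f x) ^ 2 * p x) = 1 →
          (c / D) * ∫ x, (f x) ^ 2 * Real.log ((f x) ^ 2) * p x ≤
            ∫ x, ‖gradient f x‖ ^ 2 * p x := by
  refine ⟨1 / (552 * 3200), by norm_num, fun n p D hp hlc hiso hD hdiam f hf hf1 => ?_⟩
  have h := hp.isotropicLogConcaveOn hlc hiso hdiam
  have H := h.log_sobolev (t := 1 / (3200 * D)) (by positivity) (le_of_eq (by field_simp)) hf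
    (by rwa [hp.integral_withDensity])
  rw [hp.integral_withDensity, hp.integral_withDensity] at H
  refine (mul_le_mul_of_nonneg_left H (by positivity)).trans (le_of_eq ?_)
  field_simp
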